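/- arXiv:1506.01295 — 2 statements merged into one kernel-verified Lean document; each statement's English description precedes it below -/
import Mathlib

section
/- Let U ⊆ V ⊆ ℂ^m be open sets, p ∈ U, Ω ⊆ ℝ an open connected neighbourhood of 0, and α : Ω × U → V a continuous map satisfying α(t,z) = α(t+s,z) − f(t,s,z) for some continuous function f that is real-analytic in (t,z) for all small s, t and z near p. If α(t,·) is holomorphic in z for each fixed t, then α is real-analytic in (t,z) on a neighbourhood of (0,p). -/
open Set Metric

section good
variable {E F F' : Type*} [NormedAddCommGroup E] [NormedSpace ℝ E]
  [NormedAddCommGroup F] [NormedSpace ℝ F] [NormedAddCommGroup F'] [NormedSpace ℝ F']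

theorem finDimCMM [FiniteDimensional ℝ E] [FiniteDimensional ℝ F] (k : ℕ) :
    FiniteDimensional ℝ (E [×k]→L[ℝ] F) := by
  let T : (E [×k]→L[ℝ] F) →ₗ[ℝ] MultilinearMap ℝ (fun _ : Fin k => E) F :=
    ContinuousMultilinearMap.toMultilinearMapLinear
  exact FiniteDimensional.of_injective T ContinuousMultilinearMap.toMultilinearMap_injective

/-- bounded coefficients -/
def KSet (E F : Type*) [NormedAddCommGroup E] [NormedSpace ℝ E]
    [NormedAddCommGroup F] [NormedSpace ℝ F] (C r : ℝ) : Set (∀ k : ℕ, E [×k]→L[ℝ] F) :=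
  {P | ∀ k, ‖P k‖ * (2 * r) ^ k ≤ C}

/-- uniformly analytic on a ball about zero -/
def Good (C r : ℝ) (g : E → F) : Prop :=
  ∃ P ∈ KSet E F C r, ∀ v, ‖v‖ ≤ r → g v = ∑' k, P k (fun _ => v)

theorem KSet.term_le {C r : ℝ} (hr : 0 < r) {P : ∀ k : ℕ, E [×k]→L[ℝ] F}
    (hP : P ∈ KSet E F C r) {v : E} (hv : ‖v‖ ≤ r) (k : ℕ) :
    ‖P k (fun _ => v)‖ ≤ C * (1 / 2) ^ k := by
  have h1 : ‖P k (fun _ => v)‖ ≤ ‖P k‖ * r ^ k := by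
    refine ((P k).le_opNorm _).trans ?_
    simp only [Finset.prod_const, Finset.card_univ, Fintype.card_fin]
    gcongr
  have h2 := hP k
  have : ‖P k‖ * r ^ k = (‖P k‖ * (2 * r) ^ k) * (1 / 2) ^ k := by
    rw [mul_assoc, ← mul_pow]; congr 2; ring
  rw [this] at h1
  exact h1.trans (by gcongr)

theorem summable_bd (C : ℝ) : Summable (fun k : ℕ => C * (1 / 2 : ℝ) ^ k) :=
  (summable_geometric_of_lt_one (by norm_num) (by norm_num)).mul_left C

theorem KSet.summable [CompleteSpace F] {C r : ℝ} (hr : 0 < r) {P : ∀ k : ℕ, E [×k]→L[ℝ] F}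
    (hP : P ∈ KSet E F C r) {v : E} (hv : ‖v‖ ≤ r) : Summable (fun k => P k (fun _ => v)) :=
  Summable.of_norm_bounded (summable_bd C) (fun k => KSet.term_le hr hP hv k)

theorem Good.analyticAt [CompleteSpace F] {C r : ℝ} (hr : 0 < r) {g : E → F} (h : Good C r g) :
    AnalyticAt ℝ g 0 := by
  obtain ⟨P, hP, hg⟩ := h
  let p : FormalMultilinearSeries ℝ E F := P
  refine ⟨p, ENNReal.ofReal r, ?_⟩
  refine ⟨?_, by simpa using hr, ?_⟩
  · refine FormalMultilinearSeries.le_radius_of_bound p (r := r.toNNReal) C (fun k => ?_)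
    rw [Real.coe_toNNReal _ hr.le]
    refine le_trans ?_ (hP k)
    change ‖P k‖ * r ^ k ≤ _
    gcongr
    linarith
  · intro y hy
    have hy' : ‖y‖ ≤ r := by
      rw [Metric.eball_ofReal, mem_ball_zero_iff] at hy
      exact hy.le
    rw [zero_add, hg y hy']
    exact (KSet.summable hr hP hy').hasSum

theorem Good.mono {C r C' r' : ℝ} (hr : 0 ≤ r') (hC : C ≤ C') (hrr : r' ≤ r) {g : E → F}
    (h : Good C r g) : Good C' r' g := by
  obtain ⟨P, hP, hg⟩ := h
  refine ⟨P, fun k => ?_, fun v hv => hg v (hv.trans hrr)⟩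
  refine le_trans ?_ ((hP k).trans hC)
  gcongr

theorem exists_good {g : E → F} (h : AnalyticAt ℝ g 0) : ∃ C > 0, ∃ r > 0, Good C r g := by
  obtain ⟨p, R, hp⟩ := h
  obtain ⟨R', hR'0, hR'⟩ := ENNReal.lt_iff_exists_nnreal_btwn.1 hp.r_pos
  have h1 : (R' : ENNReal) < p.radius := hR'.trans_le hp.r_le
  obtain ⟨C, hC, hb⟩ := p.norm_mul_pow_le_of_lt_radius h1
  have hR0 : (0 : ℝ) < R' := by exact_mod_cast hR'0
  refine ⟨C, hC, R' / 2, by positivity, p, fun k => ?_, fun v hv => ?_⟩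
  · have := hb k
    rwa [mul_div_cancel₀ _ (two_ne_zero)]
  · have hv2 : v ∈ Metric.eball (0 : E) R := by
      rw [Metric.mem_eball, edist_zero_right]
      refine lt_of_le_of_lt ?_ hR'
      rw [← ofReal_norm]
      rw [ENNReal.ofReal_le_iff_le_toReal (by simp)]
      simp only [ENNReal.coe_toReal]; linarith
    have := hp.hasSum hv2
    rw [zero_add] at this
    exact this.tsum_eq.symm

theorem Good.comp [CompleteSpace F] {C r M : ℝ} (hr : 0 < r) {g : E → F} (h : Good C r g)
    (L : E →L[ℝ] E) (hL : ‖L‖ ≤ 1) (A : F →L[ℝ] F') (hA : ‖A‖ ≤ M) :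
    Good (M * C) r (fun v => A (g (L v))) := by
  obtain ⟨P, hP, hg⟩ := h
  refine ⟨fun k => A.compContinuousMultilinearMap ((P k).compContinuousLinearMap (fun _ => L)),
    fun k => ?_, fun v hv => ?_⟩
  · have h1 : ‖(P k).compContinuousLinearMap (fun _ => L)‖ ≤ ‖P k‖ := by
      refine ((P k).norm_compContinuousLinearMap_le _).trans ?_
      simp only [Finset.prod_const, Finset.card_univ, Fintype.card_fin]
      exact mul_le_of_le_one_right (norm_nonneg _) (pow_le_one₀ (norm_nonneg _) hL)
    have h2 := A.norm_compContinuousMultilinearMap_le ((P k).compContinuousLinearMap (fun _ => L))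
    have hM : 0 ≤ M := (norm_nonneg _).trans hA
    calc _ ≤ (M * ‖P k‖) * (2 * r) ^ k := by
          gcongr; exact h2.trans (by gcongr)
      _ = M * (‖P k‖ * (2 * r) ^ k) := by ring
      _ ≤ _ := by gcongr; exact hP k
  · have hLv : ‖L v‖ ≤ r := by
      refine (L.le_opNorm v).trans ?_
      nlinarith [norm_nonneg v, norm_nonneg L]
    change A (g (L v)) = _
    rw [hg _ hLv, A.map_tsum (KSet.summable hr hP hLv)]
    rfl

/-- set of uniformly analytic functions -/
def goodSet (E F : Type*) [NormedAddCommGroup E] [NormedSpace ℝ E]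
    [NormedAddCommGroup F] [NormedSpace ℝ F] (C r : ℝ) : Set C(closedBall (0 : E) r, F) :=
  {φ | ∃ P ∈ KSet E F C r, ∀ v : closedBall (0 : E) r, φ v = ∑' k, P k (fun _ => (v : E))}

theorem isCompact_KSet [FiniteDimensional ℝ E] [FiniteDimensional ℝ F] {C r : ℝ} (hr : 0 < r) :
    IsCompact (KSet E F C r) := by
  have : KSet E F C r = Set.pi univ (fun k => closedBall (0 : E [×k]→L[ℝ] F) (C / (2 * r) ^ k)) := by
    ext P
    simp only [KSet, mem_ofPred_eq, mem_pi, mem_univ, true_imp_iff, mem_closedBall_zero_iff]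
    refine forall_congr' fun k => ?_
    rw [le_div_iff₀ (by positivity)]
  rw [this]
  refine isCompact_univ_pi fun k => ?_
  have := finDimCMM (E := E) (F := F) k
  have : ProperSpace (E [×k]→L[ℝ] F) := FiniteDimensional.proper ℝ _
  exact isCompact_closedBall _ _

theorem isCompact_goodSet [FiniteDimensional ℝ E] [FiniteDimensional ℝ F] {C r : ℝ} (hr : 0 < r) :
    IsCompact (goodSet E F C r) := by
  have : CompleteSpace F := FiniteDimensional.complete ℝ F
  have : CompactSpace (KSet E F C r) := isCompact_iff_compactSpace.1 (isCompact_KSet hr)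
  let Ψ : C(KSet E F C r × closedBall (0 : E) r, F) :=
    ⟨fun q => ∑' k, q.1.1 k (fun _ => (q.2 : E)), by
      refine continuous_tsum (u := fun k : ℕ => C * (1 / 2 : ℝ) ^ k) (fun k => ?_)
        (summable_bd C) (fun k q => ?_)
      · have h1 : Continuous (fun q : KSet E F C r × closedBall (0 : E) r => q.1.1 k) :=
          (continuous_apply k).comp (continuous_subtype_val.comp continuous_fst)
        have h2 : Continuous (fun q : KSet E F C r × closedBall (0 : E) r =>
            (fun _ : Fin k => (q.2 : E))) := by fun_prop
        exact h1.eval h2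
      · exact KSet.term_le hr q.1.2 (mem_closedBall_zero_iff.1 q.2.2) k⟩
  have : goodSet E F C r = range Ψ.curry := by
    ext φ
    constructor
    · rintro ⟨P, hP, h⟩
      exact ⟨⟨P, hP⟩, by ext v; exact (h v).symm⟩
    · rintro ⟨P, rfl⟩
      exact ⟨P.1, P.2, fun v => rfl⟩
  rw [this]
  exact isCompact_range Ψ.curry.continuous

theorem convex_goodSet [CompleteSpace F] {C r : ℝ} (hr : 0 < r) :
    Convex ℝ (goodSet E F C r) := by
  rintro φ ⟨P, hP, hφ⟩ ψ ⟨Q, hQ, hψ⟩ a b ha hb hab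
  refine ⟨fun k => a • P k + b • Q k, fun k => ?_, fun v => ?_⟩
  · have : ‖a • P k + b • Q k‖ ≤ a * ‖P k‖ + b * ‖Q k‖ := by
      refine (norm_add_le _ _).trans ?_
      rw [norm_smul, norm_smul, Real.norm_of_nonneg ha, Real.norm_of_nonneg hb]
    calc _ ≤ (a * ‖P k‖ + b * ‖Q k‖) * (2 * r) ^ k := by gcongr
      _ = a * (‖P k‖ * (2 * r) ^ k) + b * (‖Q k‖ * (2 * r) ^ k) := by ring
      _ ≤ a * C + b * C := by gcongr; exacts [hP k, hQ k]
      _ = C := by rw [← add_mul, hab, one_mul]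
  · have hv : ‖(v : E)‖ ≤ r := mem_closedBall_zero_iff.1 v.2
    have h1 := (KSet.summable hr hP hv)
    have h2 := (KSet.summable hr hQ hv)
    simp only [ContinuousMap.add_apply, ContinuousMap.smul_apply, hφ, hψ,
      _root_.add_apply, _root_.smul_apply]
    rw [(h1.const_smul a).tsum_add (h2.const_smul b), h1.tsum_const_smul, h2.tsum_const_smul]

theorem good_iff {C r : ℝ} {g : E → F} (φ : C(closedBall (0 : E) r, F)) (h : ∀ v, φ v = g v) :
    Good C r g ↔ φ ∈ goodSet E F C r := by
  constructor
  · rintro ⟨P, hP, hg⟩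
    exact ⟨P, hP, fun v => by rw [h]; exact hg _ (mem_closedBall_zero_iff.1 v.2)⟩
  · rintro ⟨P, hP, hg⟩
    exact ⟨P, hP, fun v hv => by rw [← h ⟨v, by simpa using hv⟩]; exact hg _⟩

open MeasureTheory in
theorem good_average [FiniteDimensional ℝ E] [FiniteDimensional ℝ F]
    {Y : Type*} [TopologicalSpace Y] [MeasurableSpace Y] [BorelSpace Y] [T2Space Y]
    [SecondCountableTopology Y]
    (μ : Measure Y) (T : Set Y) (hT : IsCompact T) (h0 : μ T ≠ 0) (hfin : μ T ≠ ⊤)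
    {C r : ℝ} (hr : 0 < r) (G : Y → E → F)
    (hG : ContinuousOn (fun q : Y × E => G q.1 q.2) (T ×ˢ closedBall 0 r))
    (hgood : ∀ y ∈ T, Good C r (G y)) :
    Good C r (fun v => ⨍ y in T, G y v ∂μ) := by
  have : CompleteSpace F := FiniteDimensional.complete ℝ F
  have : ProperSpace E := FiniteDimensional.proper ℝ E
  have : CompactSpace T := isCompact_iff_compactSpace.1 hT
  have hTm : MeasurableSet T := hT.measurableSet
  let ν : Measure T := μ.comap Subtype.val
  have hν : ν univ = μ T := by
    simp only [ν]
    rw [comap_subtype_coe_apply hTm]; simp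
  have : IsFiniteMeasure ν := ⟨by rw [hν]; exact hfin.lt_top⟩
  have : NeZero ν := ⟨fun h => h0 (by rw [← hν, h]; simp)⟩
  let Φ : C(T × closedBall (0 : E) r, F) := ⟨fun q => G q.1 q.2, by
    refine hG.comp_continuous (f := fun q : T × closedBall (0 : E) r => ((q.1 : Y), (q.2 : E)))
      (by fun_prop) (fun q => ⟨q.1.2, q.2.2⟩)⟩
  have hint : Integrable (Φ.curry : T → C(closedBall (0 : E) r, F)) ν :=
    Φ.curry.continuous.integrable_of_hasCompactSupport (HasCompactSupport.of_compactSpace _)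
  have hmem := (convex_goodSet (E := E) (F := F) (C := C) hr).average_mem (μ := ν)
    (isCompact_goodSet hr).isClosed (f := Φ.curry)
    (Filter.Eventually.of_forall fun y => (good_iff (Φ.curry y) (fun v => rfl)).1 (hgood y y.2)) hint
  refine (good_iff _ (fun v => ?_)).2 hmem
  rw [average_eq, setAverage_eq]
  have e1 : (∫ y, Φ.curry y ∂ν) v = ∫ y, G y v ∂ν :=
    ((ContinuousMap.evalCLM ℝ v).integral_comp_comm hint).symm
  rw [ContinuousMap.smul_apply, e1]
  simp only [Measure.real, hν]
  congr 1
  exact integral_subtype_comap hTm (fun y => G y v)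

end good

section osgood
open MeasureTheory Real

theorem torus_mem {m : ℕ} (c : Fin m → ℂ) {ρ : ℝ} (hρ : 0 < ρ) (θ : Fin m → ℝ) :
    torusMap c (fun _ => ρ) θ ∈ closedBall c ρ := by
  rw [mem_closedBall, dist_pi_le_iff hρ.le]
  intro i
  simp [torusMap, dist_eq_norm, abs_of_pos hρ]

theorem torus_ne {m : ℕ} (c w : Fin m → ℂ) {ρ : ℝ} (hρ : 0 < ρ) (hw : w ∈ ball c ρ)
    (θ : Fin m → ℝ) (i : Fin m) : torusMap c (fun _ => ρ) θ i - w i ≠ 0 := by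
  intro h
  rw [sub_eq_zero] at h
  have h1 : dist (w i) (c i) < ρ := (dist_le_pi_dist w c i).trans_lt hw
  rw [← h] at h1
  simp [torusMap, dist_eq_norm, abs_of_pos hρ] at h1

theorem torus_cont {m : ℕ} (c : Fin m → ℂ) (ρ : ℝ) :
    Continuous (torusMap c (fun _ => ρ)) := by
  unfold torusMap
  fun_prop

theorem cauchy_torus {F : Type*} [NormedAddCommGroup F] [NormedSpace ℂ F] [CompleteSpace F]
    {ρ : ℝ} (hρ : 0 < ρ) : ∀ (m : ℕ) (c w : Fin m → ℂ) (g : (Fin m → ℂ) → F)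
    (_ : DifferentiableOn ℂ g (closedBall c ρ)) (_ : w ∈ ball c ρ),
    torusIntegral (fun z => (∏ i, (z i - w i)⁻¹) • g z) c (fun _ => ρ)
      = ((2 * π * Complex.I : ℂ) ^ m) • g w := by
  intro m
  induction m with
  | zero =>
    intro c w g hg hw
    rw [torusIntegral_dim0]
    simp [Subsingleton.elim c w]
  | succ n ih =>
    intro c w g hg hw
    have hTI : TorusIntegrable (fun z => (∏ i, (z i - w i)⁻¹) • g z) c (fun _ => ρ) := by
      refine ContinuousOn.integrableOn_compact isCompact_Icc (Continuous.continuousOn ?_)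
      refine Continuous.smul ?_ ?_
      · refine continuous_finsetProd _ fun i _ => Continuous.inv₀ ?_ (fun θ => torus_ne c w hρ hw θ i)
        exact ((continuous_apply i).comp (torus_cont c ρ)).sub continuous_const
      · exact hg.continuousOn.comp_continuous (torus_cont c ρ) (torus_mem c hρ)
    rw [torusIntegral_succ hTI]
    have hw0 : w 0 ∈ ball (c 0) ρ := (dist_le_pi_dist w c 0).trans_lt hw
    have hws : w ∘ Fin.succ ∈ ball (c ∘ Fin.succ) ρ := by
      rw [mem_ball, dist_pi_lt_iff hρ]
      exact fun i => (dist_le_pi_dist w c i.succ).trans_lt hw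
    have hcons : ∀ x ∈ closedBall (c 0) ρ, ∀ y ∈ closedBall (c ∘ Fin.succ) ρ,
        (Fin.cons x y : Fin (n+1) → ℂ) ∈ closedBall c ρ := by
      intro x hx y hy
      rw [mem_closedBall, dist_pi_le_iff hρ.le]
      refine Fin.cases ?_ ?_
      · simpa using hx
      · intro i
        simpa using (dist_le_pi_dist y (c ∘ Fin.succ) i).trans hy
    have inner : ∀ x ∈ sphere (c 0) ρ,
        torusIntegral (fun y => (∏ i, ((Fin.cons x y : Fin (n+1) → ℂ) i - w i)⁻¹) •
          g (Fin.cons x y)) (c ∘ Fin.succ) ((fun _ => ρ) ∘ Fin.succ) =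
        (x - w 0)⁻¹ • ((2 * π * Complex.I : ℂ) ^ n • g (Fin.cons x (w ∘ Fin.succ))) := by
      intro x hx
      rw [← ih (c ∘ Fin.succ) (w ∘ Fin.succ) (fun y => g (Fin.cons x y)) ?_ hws,
        ← torusIntegral_smul]
      · congr 1
        ext y
        rw [Fin.prod_univ_succ]
        simp [mul_smul]
      · refine hg.comp ?_ (fun y hy => hcons x (sphere_subset_closedBall hx) y hy)
        refine Differentiable.differentiableOn ?_
        rw [differentiable_pi]
        refine Fin.cases ?_ ?_
        · simp
        · intro i; simp only [Fin.cons_succ]; fun_prop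
    rw [circleIntegral.integral_congr hρ.le inner]
    have hd : DifferentiableOn ℂ (fun x => (2 * π * Complex.I : ℂ) ^ n •
        g (Fin.cons x (w ∘ Fin.succ))) (closedBall (c 0) ρ) := by
      refine DifferentiableOn.const_smul ?_ _
      refine hg.comp ?_ (fun x hx => hcons x hx _ (ball_subset_closedBall hws))
      refine Differentiable.differentiableOn ?_
      rw [differentiable_pi]
      refine Fin.cases ?_ ?_
      · simp
      · intro i; simp
    have := hd.circleIntegral_sub_inv_smul hw0
    rw [this, smul_smul, ← pow_succ']
    congr 2
    ext i
    refine Fin.cases ?_ ?_ i <;> simp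

theorem osgood {m : ℕ} {F : Type*} [NormedAddCommGroup F] [NormedSpace ℂ F]
    [FiniteDimensional ℝ F] {c : Fin m → ℂ} {g : (Fin m → ℂ) → F} {s : Set (Fin m → ℂ)}
    (hg : DifferentiableOn ℂ g s) (hs : s ∈ nhds c) :
    AnalyticAt ℝ (fun w => g (c + w)) 0 := by
  have : CompleteSpace F := FiniteDimensional.complete ℝ F
  obtain ⟨ρ, hρ, hρs⟩ := nhds_basis_closedBall.mem_iff.1 hs
  have hg := hg.mono hρs
  -- kernel
  let Φ : (Fin m → ℂ) → ℂ := fun w => ∏ i, (1 - w i / ρ)⁻¹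
  have hΦ : AnalyticAt ℝ Φ 0 := by
    refine Finset.analyticAt_fun_prod _ fun i _ => ?_
    have : AnalyticAt ℂ (fun w : Fin m → ℂ => (1 - w i / ρ)) 0 := by
      have h1 : AnalyticAt ℂ (fun w : Fin m → ℂ => w i) 0 :=
        (ContinuousLinearMap.proj (R := ℂ) (φ := fun _ : Fin m => ℂ) i).analyticAt 0
      exact analyticAt_const.sub (h1.div_const)
    exact (this.inv (by simp)).restrictScalars
  obtain ⟨C, hC, r₀, hr₀, hgood⟩ := exists_good hΦ
  let r := min r₀ (ρ / 2)
  have hr : 0 < r := by positivity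
  have hrρ : r < ρ := (min_le_right _ _).trans_lt (by linarith)
  have hgood : Good C r Φ := hgood.mono hr.le le_rfl (min_le_left _ _)
  -- bound on g
  obtain ⟨M, hM⟩ : ∃ M, ∀ z ∈ closedBall c ρ, ‖g z‖ ≤ M :=
    (isCompact_closedBall c ρ).exists_bound_of_continuousOn hg.continuousOn
  let T : Set (Fin m → ℝ) := Icc 0 (fun _ => 2 * π)
  let L : (Fin m → ℝ) → (Fin m → ℂ) →L[ℝ] (Fin m → ℂ) := fun θ =>
    ContinuousLinearMap.pi fun i =>
      (Complex.exp (-(θ i * Complex.I))) • (ContinuousLinearMap.proj (R := ℝ) (φ := fun _ : Fin m => ℂ) i)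
  have hLa : ∀ θ w i, L θ w i = Complex.exp (-(θ i * Complex.I)) * w i := fun θ w i => by simp [L]
  have hexp : ∀ t : ℝ, ‖Complex.exp (-(t * Complex.I))‖ = 1 := fun t => by
    rw [show -(t * Complex.I) = ((-t : ℝ) : ℂ) * Complex.I by push_cast; ring]
    exact Complex.norm_exp_ofReal_mul_I _
  have hLn : ∀ θ, ‖L θ‖ ≤ 1 := fun θ => by
    refine ContinuousLinearMap.opNorm_le_bound _ zero_le_one fun w => ?_
    rw [one_mul, pi_norm_le_iff_of_nonneg (norm_nonneg _)]
    intro i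
    rw [hLa, norm_mul, hexp, one_mul]
    exact norm_le_pi_norm w i
  let A : (Fin m → ℝ) → ℂ →L[ℝ] F := fun θ =>
    (ContinuousLinearMap.toSpanSingleton ℂ (g (torusMap c (fun _ => ρ) θ))).restrictScalars ℝ
  have hAa : ∀ θ x, A θ x = x • g (torusMap c (fun _ => ρ) θ) := fun θ x => by simp [A]
  have hM0 : 0 ≤ M := (norm_nonneg _).trans (hM c (mem_closedBall_self hρ.le))
  have hAn : ∀ θ, ‖A θ‖ ≤ M := fun θ => by
    refine ContinuousLinearMap.opNorm_le_bound _ hM0 fun w => ?_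
    rw [hAa, norm_smul, mul_comm]
    gcongr
    exact hM _ (torus_mem c hρ θ)
  have hne : ∀ (θ : Fin m → ℝ) (w : Fin m → ℂ), ‖w‖ ≤ r → ∀ i, 1 - L θ w i / ρ ≠ 0 := by
    intro θ w hw i h
    have h1 : ‖L θ w i / ρ‖ < 1 := by
      rw [hLa, norm_div, norm_mul, hexp, one_mul, Complex.norm_real, Real.norm_of_nonneg hρ.le,
        div_lt_one hρ]
      exact ((norm_le_pi_norm w i).trans hw).trans_lt hrρ
    rw [sub_eq_zero] at h
    rw [← h] at h1
    simp at h1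
  have hvol : volume T ≠ 0 ∧ volume T ≠ ⊤ := by
    simp only [T]
    rw [Real.volume_Icc_pi]
    constructor
    · simp [Real.pi_pos]
    · exact ENNReal.prod_ne_top (fun i _ => ENNReal.ofReal_ne_top)
  have key := good_average volume T isCompact_Icc hvol.1 hvol.2 (C := M * C) hr
    (fun θ w => A θ (Φ (L θ w))) (by
      simp only [hAa, Φ]
      refine ContinuousOn.smul ?_ ?_
      · refine continuousOn_finsetProd _ fun i _ => ContinuousOn.inv₀ ?_ ?_
        · refine Continuous.continuousOn ?_
          simp only [hLa]
          fun_prop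
        · rintro ⟨θ, w⟩ ⟨_, hw⟩
          exact hne θ w (mem_closedBall_zero_iff.1 hw) i
      · refine Continuous.continuousOn ?_
        exact (hg.continuousOn.comp_continuous (torus_cont c ρ) (torus_mem c hρ)).comp continuous_fst)
    (fun θ _ => hgood.comp hr (L θ) (hLn θ) (A θ) (hAn θ))
  have key2 := key.analyticAt hr
  have hπ : (2 * π * Complex.I : ℂ) ^ m ≠ 0 := by
    refine pow_ne_zero _ ?_; simp [Real.pi_ne_zero]
  let a : ℂ := ((2 * π * Complex.I : ℂ) ^ m)⁻¹ * (Complex.I ^ m * ((volume.real T : ℝ) : ℂ))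
  have key3 : AnalyticAt ℝ (fun w => a • ⨍ θ in T, A θ (Φ (L θ w))) 0 := by
    exact AnalyticAt.comp (g := fun x : F => a • x)
      (((a • ContinuousLinearMap.id ℂ F).restrictScalars ℝ).analyticAt _) key2
  refine key3.congr ?_
  filter_upwards [Metric.closedBall_mem_nhds (0 : Fin m → ℂ) hr] with w hw
  have hw' : ‖w‖ ≤ r := mem_closedBall_zero_iff.1 hw
  have hcw : c + w ∈ ball c ρ := by
    rw [mem_ball, dist_eq_norm, add_sub_cancel_left]; exact hw'.trans_lt hrρ
  have hC := cauchy_torus hρ m c (c + w) g hg hcw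
  rw [show g (c + w) = ((2 * π * Complex.I : ℂ) ^ m)⁻¹ • ((2 * π * Complex.I : ℂ) ^ m) • g (c + w) by
    rw [inv_smul_smul₀ hπ], ← hC]
  simp only [a]
  rw [mul_smul]
  congr 1
  rw [setAverage_eq, mul_smul]
  have hv : volume.real T ≠ 0 := ENNReal.toReal_ne_zero.2 hvol
  rw [Complex.coe_smul, smul_inv_smul₀ hv, torusIntegral, ← integral_smul]
  refine setIntegral_congr_fun measurableSet_Icc fun θ _ => ?_
  simp only [hAa, smul_smul, Φ]
  congr 1
  rw [← Finset.prod_mul_distrib, show Complex.I ^ m = ∏ _i : Fin m, Complex.I by simp,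
    ← Finset.prod_mul_distrib]
  refine Finset.prod_congr rfl fun i _ => ?_
  have h1 := hne θ w hw' i
  have h2 := torus_ne c (c + w) hρ hcw θ i
  rw [hLa] at h1 ⊢
  simp only [torusMap, Pi.add_apply] at h2 ⊢
  have hρ' : (ρ : ℂ) ≠ 0 := by exact_mod_cast hρ.ne'
  rw [Complex.exp_neg] at h1 ⊢
  have he := Complex.exp_ne_zero (θ i * Complex.I)
  have e1 : c i + ρ * Complex.exp (θ i * Complex.I) - (c i + w i)
    = ρ * Complex.exp (θ i * Complex.I) *
      (1 - (Complex.exp (θ i * Complex.I))⁻¹ * w i / ρ) := by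
    field_simp; ring
  rw [e1]
  field_simp
end osgood

section main

theorem baire_good {E F : Type*} [NormedAddCommGroup E] [NormedSpace ℝ E]
    [NormedAddCommGroup F] [NormedSpace ℝ F] [FiniteDimensional ℝ E] [FiniteDimensional ℝ F]
    {G : ℝ → E → F} {a b r₀ : ℝ} (hab : a < b) (hr₀ : 0 < r₀)
    (hG : ContinuousOn (fun q : ℝ × E => G q.1 q.2) (Icc a b ×ˢ closedBall 0 r₀))
    (han : ∀ s ∈ Icc a b, AnalyticAt ℝ (G s) 0) :
    ∃ s₁ s₂ : ℝ, s₁ < s₂ ∧ Icc s₁ s₂ ⊆ Icc a b ∧ ∃ C r : ℝ, 0 < r ∧ r ≤ r₀ ∧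
      ∀ s ∈ Icc s₁ s₂, Good C r (G s) := by
  let R : ℕ → ℝ := fun N => r₀ / (N + 1)
  have hR : ∀ N, 0 < R N := fun N => by positivity
  have hRle : ∀ N, R N ≤ r₀ := fun N => by
    refine div_le_self hr₀.le ?_
    have : (0 : ℝ) ≤ N := N.cast_nonneg
    linarith
  let S : ℕ → Set (Icc a b) := fun N => {s | Good (N : ℝ) (R N) (G s)}
  have hclosed : ∀ N, IsClosed (S N) := by
    intro N
    have : ProperSpace E := FiniteDimensional.proper ℝ E
    let Φ : C(Icc a b × closedBall (0 : E) (R N), F) := ⟨fun q => G q.1 q.2, by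
      refine hG.comp_continuous
        (f := fun q : Icc a b × closedBall (0 : E) (R N) => ((q.1 : ℝ), (q.2 : E)))
        (by fun_prop) (fun q => ⟨q.1.2, closedBall_subset_closedBall (hRle N) q.2.2⟩)⟩
    have : S N = Φ.curry ⁻¹' (goodSet E F N (R N)) := by
      ext s
      exact good_iff (Φ.curry s) (fun v => rfl)
    rw [this]
    exact (isCompact_goodSet (hR N)).isClosed.preimage Φ.curry.continuous
  have hcover : ⋃ N, S N = univ := by
    refine eq_univ_of_forall fun s => mem_iUnion.2 ?_
    obtain ⟨C, hC, r, hr, hgood⟩ := exists_good (han s s.2)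
    obtain ⟨N, hN⟩ := exists_nat_ge (max C (r₀ / r))
    refine ⟨N, hgood.mono (hR N).le ((le_max_left _ _).trans hN) ?_⟩
    have h1 : r₀ / r ≤ N := (le_max_right _ _).trans hN
    rw [div_le_iff₀ hr] at h1
    simp only [R]
    rw [div_le_iff₀ (by positivity)]
    nlinarith
  have : Nonempty (Icc a b) := ⟨⟨a, left_mem_Icc.2 hab.le⟩⟩
  obtain ⟨N, s, hs⟩ := nonempty_interior_of_iUnion_of_closed hclosed hcover
  obtain ⟨O, hO, hOS⟩ := isOpen_induced_iff.1 (isOpen_interior (s := S N))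
  have hsO : (s : ℝ) ∈ O := by
    have : s ∈ Subtype.val ⁻¹' O := by rw [hOS]; exact hs
    exact this
  have hscl : (s : ℝ) ∈ closure (Ioo a b) := by rw [closure_Ioo hab.ne]; exact s.2
  obtain ⟨x, hxO, hx⟩ := mem_closure_iff.1 hscl O hO hsO
  obtain ⟨δ, hδ, hsub⟩ := nhds_basis_closedBall.mem_iff.1 ((hO.inter isOpen_Ioo).mem_nhds ⟨hxO, hx⟩)
  rw [Real.closedBall_eq_Icc] at hsub
  have hsub2 : Icc (x - δ) (x + δ) ⊆ Icc a b := fun y hy => Ioo_subset_Icc_self (hsub hy).2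
  refine ⟨x - δ, x + δ, by linarith, hsub2, N, R N, hR N, hRle N, fun y hy => ?_⟩
  have h1 : (⟨y, hsub2 hy⟩ : Icc a b) ∈ interior (S N) := by
    rw [← hOS]; exact (hsub hy).1
  have h2 : (⟨y, hsub2 hy⟩ : Icc a b) ∈ S N := interior_subset h1
  exact h2

/-- parametric primitive -/
theorem analytic_integral {E F : Type*} [NormedAddCommGroup E] [NormedSpace ℝ E]
    [NormedAddCommGroup F] [NormedSpace ℝ F] [FiniteDimensional ℝ E] [FiniteDimensional ℝ F]
    {h : ℝ × E → F} (hh : AnalyticAt ℝ h 0) :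
    AnalyticAt ℝ (fun q : ℝ × E => ∫ u in (0 : ℝ)..1, h (u * q.1, q.2)) 0 := by
  have : CompleteSpace F := FiniteDimensional.complete ℝ F
  obtain ⟨C, hC, r₁, hr₁, hgood⟩ := exists_good hh
  obtain ⟨r₂, hr₂, hcont⟩ := nhds_basis_closedBall.mem_iff.1 hh.eventually_analyticAt
  let r := min r₁ r₂
  have hr : 0 < r := lt_min hr₁ hr₂
  let L : ℝ → (ℝ × E) →L[ℝ] (ℝ × E) := fun u =>
    (u • ContinuousLinearMap.fst ℝ ℝ E).prod (ContinuousLinearMap.snd ℝ ℝ E)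
  have hLn : ∀ u ∈ Icc (0 : ℝ) 1, ‖L u‖ ≤ 1 := by
    intro u hu
    refine ContinuousLinearMap.opNorm_le_bound _ zero_le_one fun q => ?_
    rw [one_mul]
    refine max_le ?_ (norm_snd_le q)
    change ‖u • q.1‖ ≤ _
    rw [norm_smul, Real.norm_of_nonneg hu.1]
    exact (mul_le_of_le_one_left (norm_nonneg _) hu.2).trans (norm_fst_le q)
  have key := good_average MeasureTheory.volume (Icc (0 : ℝ) 1) isCompact_Icc (by simp) (by simp)
    hr (C := 1 * C) (fun u q => (ContinuousLinearMap.id ℝ F) (h (L u q))) (by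
      have hc : ContinuousOn h (closedBall 0 r) := fun x hx =>
        (hcont (closedBall_subset_closedBall (min_le_right _ _) hx)).continuousAt.continuousWithinAt
      refine hc.comp (f := fun q : ℝ × (ℝ × E) => L q.1 q.2) (Continuous.continuousOn ?_) ?_
      · change Continuous (fun q : ℝ × (ℝ × E) => (q.1 • q.2.1, q.2.2))
        fun_prop
      · rintro ⟨u, q⟩ ⟨hu, hq⟩
        rw [mem_closedBall_zero_iff] at hq ⊢
        refine ((L u).le_opNorm q).trans ((mul_le_of_le_one_left (norm_nonneg _) (hLn u hu)).trans hq))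
    (fun u hu => (hgood.mono hr.le le_rfl (min_le_left _ _)).comp hr (L u) (hLn u hu)
      (ContinuousLinearMap.id ℝ F) ContinuousLinearMap.norm_id_le)
  refine (key.analyticAt hr).congr (Filter.Eventually.of_forall fun q => ?_)
  simp only
  rw [MeasureTheory.setAverage_eq, intervalIntegral.integral_of_le zero_le_one,
    ← MeasureTheory.integral_Icc_eq_integral_Ioc]
  simp [L]

end main


/-- the integration lemma (Lemma on analyticity of α). -/
theorem stmt_0 {m : ℕ} (U V : Set (Fin m → ℂ)) (hU : IsOpen U) (hV : IsOpen V)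
    (hUV : U ⊆ V) (p : Fin m → ℂ) (hp : p ∈ U)
    (Ω : Set ℝ) (hΩ : IsOpen Ω) (hΩc : IsConnected Ω) (h0 : (0 : ℝ) ∈ Ω)
    (α : ℝ → (Fin m → ℂ) → (Fin m → ℂ))
    (hαcont : ContinuousOn (fun q : ℝ × (Fin m → ℂ) => α q.1 q.2) (Ω ×ˢ U))
    (hαmaps : ∀ t ∈ Ω, ∀ z ∈ U, α t z ∈ V)
    (hαhol : ∀ t ∈ Ω, DifferentiableOn ℂ (α t) U)
    (f : ℝ → ℝ → (Fin m → ℂ) → (Fin m → ℂ))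
    (ε : ℝ) (hε : 0 < ε) (hεΩ : Ioo (-ε) ε ⊆ Ω)
    (W : Set (Fin m → ℂ)) (hW : IsOpen W) (hpW : p ∈ W) (hWU : W ⊆ U)
    (hfcont : ContinuousOn
      (fun q : ℝ × ℝ × (Fin m → ℂ) => f q.1 q.2.1 q.2.2)
      (Ioo (-ε) ε ×ˢ Ioo (-ε) ε ×ˢ W))
    (hfan : ∀ s ∈ Ioo (-ε) ε, ∀ t ∈ Ioo (-ε) ε, ∀ z ∈ W,
      AnalyticAt ℝ (fun q : ℝ × (Fin m → ℂ) => f q.1 s q.2) (t, z))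
    (heq : ∀ s ∈ Ioo (-ε) ε, ∀ t ∈ Ioo (-ε) ε, ∀ z ∈ W,
      α t z = α (t + s) z - f t s z) :
    AnalyticAt ℝ (fun q : ℝ × (Fin m → ℂ) => α q.1 q.2) (0, p) := by
  obtain ⟨r', hr', hr'W⟩ := nhds_basis_closedBall.mem_iff.1 (hW.mem_nhds hpW)
  let r₀ := min r' (ε / 4)
  have hr₀ : 0 < r₀ := lt_min hr' (by positivity)
  have hr₀ε : r₀ ≤ ε / 4 := min_le_right _ _
  have hzW : ∀ w : Fin m → ℂ, ‖w‖ ≤ r₀ → p + w ∈ W := fun w hw => by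
    apply hr'W
    rw [mem_closedBall, dist_eq_norm, add_sub_cancel_left]
    exact hw.trans (min_le_left _ _)
  have ht : ∀ t : ℝ, |t| ≤ r₀ → t ∈ Ioo (-ε) ε := fun t ht => by
    have := abs_le.1 ht
    constructor <;> linarith [this.1, this.2]
  have hs : ∀ s ∈ Icc (-(ε / 4)) (ε / 4), s ∈ Ioo (-ε) ε := fun s hs => by
    constructor <;> linarith [hs.1, hs.2]
  let G : ℝ → ℝ × (Fin m → ℂ) → (Fin m → ℂ) := fun s v => f v.1 s (p + v.2)
  have hGc : ContinuousOn (fun q : ℝ × (ℝ × (Fin m → ℂ)) => G q.1 q.2)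
      (Icc (-(ε / 4)) (ε / 4) ×ˢ closedBall 0 r₀) := by
    refine hfcont.comp (f := fun q : ℝ × (ℝ × (Fin m → ℂ)) => (q.2.1, q.1, p + q.2.2))
      (Continuous.continuousOn (by fun_prop)) ?_
    rintro ⟨s, t, w⟩ ⟨h1, h2⟩
    rw [mem_closedBall_zero_iff] at h2
    exact ⟨ht t ((norm_fst_le (t, w)).trans h2), hs s h1, hzW w ((norm_snd_le (t, w)).trans h2)⟩
  have hshift : AnalyticAt ℝ (fun v : ℝ × (Fin m → ℂ) => (v.1, p + v.2)) 0 :=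
    analyticAt_fst.prod (analyticAt_const.add analyticAt_snd)
  have hGan : ∀ s ∈ Icc (-(ε / 4)) (ε / 4), AnalyticAt ℝ (G s) 0 := fun s h1 =>
    AnalyticAt.comp_of_eq (g := fun q : ℝ × (Fin m → ℂ) => f q.1 s q.2)
      (hfan s (hs s h1) 0 (by constructor <;> linarith) p hpW) hshift (by simp)
  obtain ⟨s₁, s₂, hs12, hsub, C, r₁, hr₁, hr₁₀, hgood⟩ :=
    baire_good (by linarith) hr₀ hGc hGan
  have hm1 : s₁ ∈ Icc (-(ε / 4)) (ε / 4) := hsub (left_mem_Icc.2 hs12.le)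
  have hm2 : s₂ ∈ Icc (-(ε / 4)) (ε / 4) := hsub (right_mem_Icc.2 hs12.le)
  have hc0 : s₂ - s₁ ≠ 0 := by linarith
  let Gb : ℝ × (Fin m → ℂ) → (Fin m → ℂ) := fun v => (s₂ - s₁)⁻¹ • ∫ s in s₁..s₂, G s v
  have hGb : AnalyticAt ℝ Gb 0 := by
    have key := good_average MeasureTheory.volume (Icc s₁ s₂) isCompact_Icc (by simp [hs12])
      (by simp) hr₁ G (hGc.mono (prod_mono hsub (closedBall_subset_closedBall hr₁₀))) hgood
    refine (key.analyticAt hr₁).congr (Filter.Eventually.of_forall fun v => ?_)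
    simp only [Gb]
    rw [MeasureTheory.setAverage_eq, intervalIntegral.integral_of_le hs12.le,
      ← MeasureTheory.integral_Icc_eq_integral_Ioc]
    simp [hs12.le]
  let h : ℝ × (Fin m → ℂ) → (Fin m → ℂ) := fun v =>
    (s₂ - s₁)⁻¹ • (G s₂ v - G s₁ v) - fderiv ℝ Gb v (1, 0)
  have hh : AnalyticAt ℝ h 0 := by
    refine AnalyticAt.sub ?_ ?_
    · exact AnalyticAt.comp (g := fun x : Fin m → ℂ => (s₂ - s₁)⁻¹ • x)
        (((s₂ - s₁)⁻¹ • ContinuousLinearMap.id ℝ (Fin m → ℂ)).analyticAt _)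
        ((hGan _ hm2).sub (hGan _ hm1))
    · exact AnalyticAt.comp
        (g := fun D : (ℝ × (Fin m → ℂ)) →L[ℝ] (Fin m → ℂ) => D (1, 0))
        ((ContinuousLinearMap.apply ℝ (Fin m → ℂ) ((1, 0) : ℝ × (Fin m → ℂ))).analyticAt _)
        hGb.fderiv
  obtain ⟨r₂, hr₂, han⟩ := nhds_basis_closedBall.mem_iff.1
    (hGb.eventually_analyticAt.and hh.eventually_analyticAt)
  let r := min r₀ r₂
  have hr : 0 < r := lt_min hr₀ hr₂
  have hαc : ∀ w : Fin m → ℂ, ‖w‖ ≤ r₀ → ContinuousOn (fun u => α u (p + w)) (Ioo (-ε) ε) := by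
    intro w hw
    exact hαcont.comp (f := fun u : ℝ => (u, p + w)) (Continuous.continuousOn (by fun_prop))
      (fun u hu => ⟨hεΩ hu, hWU (hzW w hw)⟩)
  have hαint : ∀ w : Fin m → ℂ, ‖w‖ ≤ r₀ → ∀ x ∈ Ioo (-ε) ε, ∀ y ∈ Ioo (-ε) ε,
      IntervalIntegrable (fun u => α u (p + w)) MeasureTheory.volume x y := by
    intro w hw x hx y hy
    exact ((hαc w hw).mono (ordConnected_Ioo.uIcc_subset hx hy)).intervalIntegrable
  have hadd : ∀ t : ℝ, |t| ≤ r₀ → ∀ s ∈ Icc (-(ε / 4)) (ε / 4), t + s ∈ Ioo (-ε) ε := by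
    intro t h1 s h2
    have := abs_le.1 h1
    constructor <;> linarith [this.1, this.2, h2.1, h2.2]
  have hident : ∀ t : ℝ, |t| ≤ r₀ → ∀ w : Fin m → ℂ, ‖w‖ ≤ r₀ →
      α t (p + w) = (s₂ - s₁)⁻¹ • ((∫ u in (0 : ℝ)..(t + s₂), α u (p + w))
        - ∫ u in (0 : ℝ)..(t + s₁), α u (p + w)) - Gb (t, w) := by
    intro t htr w hw
    have h0' : (0 : ℝ) ∈ Ioo (-ε) ε := by constructor <;> linarith
    rw [intervalIntegral.integral_interval_sub_left
      (hαint w hw _ h0' _ (hadd t htr _ hm2)) (hαint w hw _ h0' _ (hadd t htr _ hm1))]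
    have e1 : ∫ s in s₁..s₂, G s (t, w) = ∫ s in s₁..s₂, (α (t + s) (p + w) - α t (p + w)) := by
      refine intervalIntegral.integral_congr fun s hsm => ?_
      rw [uIcc_of_le hs12.le] at hsm
      have := heq s (hs s (hsub hsm)) t (ht t htr) (p + w) (hzW w hw)
      simp only [G]
      rw [this]; abel
    simp only [Gb]
    rw [e1, intervalIntegral.integral_sub, intervalIntegral.integral_const,
      intervalIntegral.integral_comp_add_left (fun u => α u (p + w)), smul_sub, inv_smul_smul₀ hc0]
    · abel
    · refine ContinuousOn.intervalIntegrable ?_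
      refine (hαc w hw).comp (f := fun s => t + s) (Continuous.continuousOn (by fun_prop)) ?_
      intro s hsm
      rw [uIcc_of_le hs12.le] at hsm
      exact hadd t htr s (hsub hsm)
    · exact intervalIntegrable_const
  have hderivInt : ∀ w : Fin m → ℂ, ‖w‖ ≤ r₀ → ∀ t : ℝ, |t| ≤ r₀ → ∀ s ∈ Icc (-(ε / 4)) (ε / 4),
      HasDerivAt (fun t => ∫ u in (0 : ℝ)..(t + s), α u (p + w)) (α (t + s) (p + w)) t := by
    intro w hw t htr s hsm
    have h0' : (0 : ℝ) ∈ Ioo (-ε) ε := by constructor <;> linarith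
    have hts := hadd t htr s hsm
    refine HasDerivAt.comp_add_const t s (f := fun x => ∫ u in (0 : ℝ)..x, α u (p + w)) ?_
    exact intervalIntegral.integral_hasDerivAt_right (hαint w hw _ h0' _ hts)
      ((hαc w hw).stronglyMeasurableAtFilter isOpen_Ioo _ hts)
      ((hαc w hw).continuousAt (isOpen_Ioo.mem_nhds hts))
  have hderiv : ∀ w : Fin m → ℂ, ‖w‖ ≤ r → ∀ t : ℝ, |t| < r →
      HasDerivAt (fun t => α t (p + w)) (h (t, w)) t := by
    intro w hw t htr
    have hw0 : ‖w‖ ≤ r₀ := hw.trans (min_le_left _ _)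
    have ht0 : |t| ≤ r₀ := htr.le.trans (min_le_left _ _)
    have hmem : (t, w) ∈ closedBall (0 : ℝ × (Fin m → ℂ)) r₂ := by
      rw [mem_closedBall_zero_iff]
      exact (max_le htr.le hw).trans (min_le_right _ _)
    have hd1 : HasDerivAt (fun t => Gb (t, w)) (fderiv ℝ Gb (t, w) (1, 0)) t := by
      have h1 := (han hmem).1.differentiableAt.hasFDerivAt
      exact h1.comp_hasDerivAt (f := fun t => (t, w)) t ((hasDerivAt_id t).prodMk (hasDerivAt_const t w))
    have hd2 := (((hderivInt w hw0 t ht0 s₂ hm2).sub (hderivInt w hw0 t ht0 s₁ hm1)).const_smul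
      (s₂ - s₁)⁻¹).sub hd1
    have e2 : α (t + s₂) (p + w) - α (t + s₁) (p + w) = G s₂ (t, w) - G s₁ (t, w) := by
      have h1 := heq s₁ (hs s₁ hm1) t (ht t ht0) (p + w) (hzW w hw0)
      have h2 := heq s₂ (hs s₂ hm2) t (ht t ht0) (p + w) (hzW w hw0)
      simp only [G]
      rw [h1, sub_eq_sub_iff_add_eq_add] at h2
      rw [sub_eq_sub_iff_add_eq_add, add_comm (f t s₂ (p + w)), h2]
    rw [e2] at hd2
    refine hd2.congr_of_eventuallyEq ?_
    have hnb : {x : ℝ | |x| < r} ∈ nhds t :=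
      (isOpen_lt continuous_abs continuous_const).mem_nhds htr
    filter_upwards [hnb] with x hx
    exact hident x ((le_of_lt hx).trans (min_le_left _ _)) w hw0
  have hfinal : AnalyticAt ℝ (fun v : ℝ × (Fin m → ℂ) =>
      α 0 (p + v.2) + v.1 • ∫ u in (0 : ℝ)..1, h (u * v.1, v.2)) 0 := by
    refine AnalyticAt.add ?_ (analyticAt_fst.smul (analytic_integral hh))
    exact AnalyticAt.comp_of_eq (g := fun w => α 0 (p + w))
      (osgood (hαhol 0 h0) (hU.mem_nhds hp)) analyticAt_snd (by simp)
  have hfinal2 : AnalyticAt ℝ (fun v : ℝ × (Fin m → ℂ) => α v.1 (p + v.2)) 0 := by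
    refine hfinal.congr ?_
    filter_upwards [ball_mem_nhds (0 : ℝ × (Fin m → ℂ)) hr] with v hv
    rw [mem_ball_zero_iff] at hv
    obtain ⟨t, w⟩ := v
    have htr : |t| < r := (norm_fst_le (t, w)).trans_lt hv
    have hw : ‖w‖ ≤ r := (norm_snd_le (t, w)).trans hv.le
    have hux : ∀ x ∈ uIcc 0 t, |x| < r := by
      intro x hx
      have h1 := abs_lt.1 htr
      have : x ∈ Ioo (-r) r := ordConnected_Ioo.uIcc_subset
        (by constructor <;> linarith) (show t ∈ Ioo (-r) r from h1) hx
      exact abs_lt.2 this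
    have e3 : ∫ u in (0 : ℝ)..t, h (u, w) = α t (p + w) - α 0 (p + w) := by
      refine intervalIntegral.integral_eq_sub_of_hasDerivAt
        (f := fun t => α t (p + w)) (fun x hx => hderiv w hw x (hux x hx)) ?_
      refine ContinuousOn.intervalIntegrable fun x hx => ContinuousAt.continuousWithinAt ?_
      have hmem : (x, w) ∈ closedBall (0 : ℝ × (Fin m → ℂ)) r₂ := by
        rw [mem_closedBall_zero_iff]
        exact (max_le (hux x hx).le hw).trans (min_le_right _ _)
      exact ContinuousAt.comp (f := fun u => (u, w)) (g := h) (han hmem).2.continuousAt (by fun_prop)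
    have e4 := intervalIntegral.smul_integral_comp_mul_right (a := 0) (b := 1) (fun u => h (u, w)) t
    simp only [zero_mul, one_mul] at e4
    simp only
    rw [e4, e3]; abel
  have hback : AnalyticAt ℝ (fun q : ℝ × (Fin m → ℂ) => (q.1, q.2 - p)) (0, p) :=
    analyticAt_fst.prod (analyticAt_snd.sub analyticAt_const)
  have := AnalyticAt.comp_of_eq hfinal2 hback (by simp)
  refine this.congr (Filter.Eventually.of_forall fun q => ?_)
  simp
end

section
/- Let U ⊆ ℂ^m be a connected open set and φ_k : U → ℂ^m a sequence of injective holomorphic maps converging locally uniformly to a holomorphic map φ : U → ℂ^m. If there exists x ∈ U with det Dφ(x) ≠ 0, then det Dφ(z) ≠ 0 for all z ∈ U and φ is injective. -/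
open Set

section SCV
open Filter Topology Metric

theorem cauchy_fderiv {E F : Type*} [NormedAddCommGroup E] [NormedSpace ℂ E]
    [NormedAddCommGroup F] [NormedSpace ℂ F] {f : E → F} {z : E} {r M : ℝ} (hr : 0 < r)
    (hf : ∀ w ∈ closedBall z r, DifferentiableAt ℂ f w)
    (hM : ∀ w ∈ closedBall z r, ‖f w‖ ≤ M) : ‖fderiv ℂ f z‖ ≤ M / r := by
  have hz : z ∈ closedBall z r := mem_closedBall_self hr.le
  have hM0 : 0 ≤ M := (norm_nonneg _).trans (hM z hz)
  refine ContinuousLinearMap.opNorm_le_bound _ (by positivity) fun v => ?_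
  by_cases hv : v = 0
  · simp [hv]
  have hv' : 0 < ‖v‖ := norm_pos_iff.2 hv
  have hmem : ∀ ζ ∈ closedBall (0 : ℂ) (r / ‖v‖), z + ζ • v ∈ closedBall z r := by
    intro ζ hζ
    rw [mem_closedBall_zero_iff] at hζ
    rw [mem_closedBall, dist_eq_norm, add_sub_cancel_left, norm_smul]
    rwa [le_div_iff₀ hv'] at hζ
  have hl : ∀ ζ : ℂ, HasDerivAt (fun ζ : ℂ => z + ζ • v) v ζ := fun ζ => by
    simpa using ((hasDerivAt_id ζ).smul_const v).const_add z
  have hd : ∀ ζ ∈ closedBall (0 : ℂ) (r / ‖v‖), DifferentiableAt ℂ (fun ζ : ℂ => f (z + ζ • v)) ζ :=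
    fun ζ hζ => (hf _ (hmem ζ hζ)).comp ζ (hl ζ).differentiableAt
  have hR : 0 < r / ‖v‖ := by positivity
  have h1 := Complex.norm_deriv_le_of_forall_mem_sphere_norm_le (C := M) hR
    (DifferentiableOn.diffContOnCl_ball (f := fun ζ : ℂ => f (z + ζ • v)) (U := closedBall 0 (r / ‖v‖)) (c := 0) (R := r / ‖v‖)
      (fun ζ hζ => (hd ζ hζ).differentiableWithinAt) subset_rfl)
    (fun ζ hζ => hM _ (hmem ζ (sphere_subset_closedBall hζ)))
  have h2 : HasDerivAt (fun ζ : ℂ => f (z + ζ • v)) (fderiv ℂ f z v) 0 := by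
    have : HasFDerivAt f (fderiv ℂ f z) (z + (0 : ℂ) • v) := by
      simpa using (hf z hz).hasFDerivAt
    exact this.comp_hasDerivAt (0 : ℂ) (hl 0)
  rw [h2.deriv] at h1
  calc _ ≤ _ := h1
    _ = _ := by field_simp

theorem fderiv_lip {E F : Type*} [NormedAddCommGroup E] [NormedSpace ℂ E]
    [NormedAddCommGroup F] [NormedSpace ℂ F] {f : E → F} {z0 : E} {r M : ℝ} (hr : 0 < r)
    (hf : ∀ w ∈ ball z0 (4 * r), DifferentiableAt ℂ f w)
    (hM : ∀ w ∈ ball z0 (4 * r), ‖f w‖ ≤ M) {z w : E} (hz : z ∈ ball z0 r) (hw : w ∈ ball z0 r) :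
    ‖fderiv ℂ f z - fderiv ℂ f w‖ ≤ M / r / r * ‖w - z‖ := by
  let _ : NormedSpace ℝ E := NormedSpace.restrictScalars ℝ ℂ E
  rw [mem_ball] at hz hw
  have h1 : ∀ x ∈ ball z0 (3 * r), ‖fderiv ℂ f x‖ ≤ M / r := by
    intro x hx
    rw [mem_ball] at hx
    have : closedBall x r ⊆ ball z0 (4 * r) := fun y hy => by
      rw [mem_closedBall] at hy
      rw [mem_ball]; linarith [dist_triangle y x z0]
    exact cauchy_fderiv hr (fun w hw => hf w (this hw)) (fun w hw => hM w (this hw))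
  have h34 : ball z0 (3 * r) ⊆ ball z0 (4 * r) := ball_subset_ball (by linarith)
  have h2 : ∀ x ∈ ball z0 (3 * r), ∀ y ∈ ball z0 (3 * r), ‖f y - f x‖ ≤ M / r * ‖y - x‖ :=
    fun x hx y hy => Convex.norm_image_sub_le_of_norm_fderiv_le (fun x hx => hf x (h34 hx)) h1
      (convex_ball _ _) hx hy
  have hm1 : ∀ x ∈ closedBall z r, x ∈ ball z0 (3 * r) := fun x hx => by
    rw [mem_closedBall] at hx
    rw [mem_ball]; linarith [dist_triangle x z z0]
  have hm2 : ∀ x ∈ closedBall z r, x + (w - z) ∈ ball z0 (3 * r) := fun x hx => by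
    rw [mem_closedBall] at hx
    have : dist (x + (w - z)) w = dist x z := by
      rw [dist_eq_norm, dist_eq_norm]; congr 1; abel
    rw [mem_ball]; linarith [dist_triangle (x + (w - z)) w z0]
  have hd2 : ∀ x ∈ closedBall z r, HasFDerivAt (fun x => f (x + (w - z))) (fderiv ℂ f (x + (w - z))) x :=
    fun x hx => by
      have := (hf _ (h34 (hm2 x hx))).hasFDerivAt
      exact (hasFDerivAt_comp_add_right (w - z)).2 this
  have hd1 : ∀ x ∈ closedBall z r, HasFDerivAt f (fderiv ℂ f x) x :=
    fun x hx => (hf _ (h34 (hm1 x hx))).hasFDerivAt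
  have h3 := cauchy_fderiv (f := fun x => f x - f (x + (w - z))) (M := M / r * ‖w - z‖) hr
    (fun x hx => ((hd1 x hx).sub (hd2 x hx)).differentiableAt)
    (fun x hx => by
      have := h2 _ (hm2 x hx) _ (hm1 x hx)
      refine this.trans_eq ?_
      rw [sub_add_cancel_left, norm_neg])
  have hz' := mem_closedBall_self (x := z) hr.le
  have h4 := ((hd1 z hz').sub (hd2 z hz')).fderiv
  have h5 : (fun x => f x - f (x + (w - z))) = f - fun x => f (x + (w - z)) := rfl
  rw [h5, h4] at h3
  rw [add_sub_cancel] at h3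
  refine h3.trans_eq ?_
  ring

theorem unif_limit_diff {E F : Type*} [NormedAddCommGroup E] [NormedSpace ℂ E]
    [NormedAddCommGroup F] [NormedSpace ℂ F] [CompleteSpace F] {f : ℕ → E → F} {g : E → F} {z0 : E} {r : ℝ}
    (hr : 0 < r) (hf : ∀ n, ∀ w ∈ ball z0 (2 * r), DifferentiableAt ℂ (f n) w)
    (hu : TendstoUniformlyOn f g atTop (ball z0 (2 * r))) : DifferentiableAt ℂ g z0 := by
  have hsub : ball z0 r ⊆ ball z0 (2 * r) := ball_subset_ball (by linarith)
  have hc : UniformCauchySeqOn (fun n => fderiv ℂ (f n)) atTop (ball z0 r) := by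
    rw [Metric.uniformCauchySeqOn_iff]
    intro ε hε
    obtain ⟨N, hN⟩ := Metric.uniformCauchySeqOn_iff.1 hu.uniformCauchySeqOn (ε / 2 * (r / 2)) (by positivity)
    refine ⟨N, fun m hm n hn x hx => ?_⟩
    have hcb : closedBall x (r / 2) ⊆ ball z0 (2 * r) := fun y hy => by
      rw [mem_ball] at hx ⊢
      rw [mem_closedBall] at hy
      linarith [dist_triangle y x z0]
    have := cauchy_fderiv (f := f m - f n) (z := x) (r := r / 2) (M := ε / 2 * (r / 2)) (by positivity)
      (fun w hw => (hf m w (hcb hw)).sub (hf n w (hcb hw)))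
      (fun w hw => by
        have := hN m hm n hn w (hcb hw)
        rw [dist_eq_norm] at this
        exact this.le)
    rw [fderiv_sub (hf m x (hsub hx)) (hf n x (hsub hx))] at this
    rw [dist_eq_norm]
    have h2 : ε / 2 * (r / 2) / (r / 2) = ε / 2 := by field_simp
    rw [h2] at this
    linarith
  have hlim : ∀ x ∈ ball z0 r, ∃ L, Tendsto (fun n => fderiv ℂ (f n) x) atTop (𝓝 L) := by
    intro x hx
    exact cauchySeq_tendsto_of_complete (hc.cauchySeq hx)
  choose! L hL using hlim
  have := hc.tendstoUniformlyOn_of_tendsto hL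
  exact (hasFDerivAt_of_tendstoUniformlyOn isOpen_ball this
    (fun n x hx => (hf n x (hsub hx)).hasFDerivAt) (fun x hx => hu.tendsto_at (hsub hx))
    (mem_ball_self hr)).differentiableAt

theorem dirDeriv_diff {E F : Type*} [NormedAddCommGroup E] [NormedSpace ℂ E]
    [NormedAddCommGroup F] [NormedSpace ℂ F] [CompleteSpace F] {f : E → F} {U : Set E} (hU : IsOpen U)
    (hf : DifferentiableOn ℂ f U) (v : E) : DifferentiableOn ℂ (fun z => fderiv ℂ f z v) U := by
  let _ : NormedSpace ℝ E := NormedSpace.restrictScalars ℝ ℂ E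
  intro z0 hz0
  apply DifferentiableAt.differentiableWithinAt
  -- choose a radius
  obtain ⟨R, hR, hRU⟩ : ∃ R > 0, ∀ w ∈ ball z0 R, w ∈ U ∧ ‖f w‖ ≤ ‖f z0‖ + 1 := by
    have h1 : ∀ᶠ w in 𝓝 z0, w ∈ U := hU.mem_nhds hz0
    have h2 : ∀ᶠ w in 𝓝 z0, ‖f w‖ < ‖f z0‖ + 1 :=
      (((hf z0 hz0).differentiableAt h1).continuousAt.norm.eventually_lt continuousAt_const (by simp))
    obtain ⟨R, hR, h⟩ := Metric.eventually_nhds_iff_ball.1 (h1.and h2)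
    exact ⟨R, hR, fun w hw => ⟨(h w hw).1, (h w hw).2.le⟩⟩
  set M := ‖f z0‖ + 1
  have hM0 : 0 ≤ M := by positivity
  obtain ⟨r, hr, hrR⟩ : ∃ r > 0, 4 * r = R := ⟨R / 4, by positivity, by ring⟩
  subst hrR
  have hd : ∀ w ∈ ball z0 (4 * r), DifferentiableAt ℂ f w := fun w hw =>
    (hf w (hRU w hw).1).differentiableAt (hU.mem_nhds (hRU w hw).1)
  have hlip := fun z hz w hw => fderiv_lip (z := z) (w := w) hr hd (fun w hw => (hRU w hw).2) hz hw
  set C := M / r / r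
  have hC0 : 0 ≤ C := by positivity
  obtain ⟨c, hc, hcv⟩ : ∃ c : ℝ, 0 < c ∧ c * ‖v‖ < r / 2 := by
    refine ⟨r / 2 / (‖v‖ + 1), by positivity, ?_⟩
    rw [div_mul_eq_mul_div, div_lt_iff₀ (by positivity)]
    nlinarith [norm_nonneg v]
  set t : ℕ → ℝ := fun n => c * (1 / ((n : ℝ) + 1)) with ht
  have ht0 : ∀ n, 0 < t n := fun n => by positivity
  have htc : ∀ n, t n ≤ c := fun n => by
    refine mul_le_of_le_one_right hc.le ?_
    rw [div_le_one (by positivity)]; simp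
  have htl : Tendsto t atTop (𝓝 0) := by
    simpa [ht] using (tendsto_one_div_add_atTop_nhds_zero_nat (𝕜 := ℝ)).const_mul c
  have hnt : ∀ n, ‖((t n : ℂ)) • v‖ = t n * ‖v‖ := fun n => by
    rw [norm_smul, Complex.norm_real, Real.norm_of_nonneg (ht0 n).le]
  have hmem : ∀ n, ∀ z ∈ ball z0 (r / 2), z + (t n : ℂ) • v ∈ ball z0 r := fun n z hz => by
    rw [mem_ball] at *
    have : dist (z + (t n : ℂ) • v) z ≤ c * ‖v‖ := by
      rw [dist_eq_norm, add_sub_cancel_left, hnt]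
      gcongr; exact htc n
    linarith [dist_triangle (z + (t n : ℂ) • v) z z0]
  have h14 : ball z0 r ⊆ ball z0 (4 * r) := ball_subset_ball (by linarith)
  have hh : ball z0 (r / 2) ⊆ ball z0 r := ball_subset_ball (by linarith)
  refine unif_limit_diff (r := r / 4) (f := fun n z => (t n : ℂ)⁻¹ • (f (z + (t n : ℂ) • v) - f z)) (by positivity) ?_ ?_
  · intro n w hw
    rw [show 2 * (r / 4) = r / 2 by ring] at hw
    have h1 : DifferentiableAt ℂ (fun z => f (z + (t n : ℂ) • v)) w :=
      ((hasFDerivAt_comp_add_right _).2 (hd _ (h14 (hmem n w hw))).hasFDerivAt).differentiableAt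
    exact (h1.sub (hd w (h14 (hh hw)))).const_smul _
  · rw [show 2 * (r / 4) = r / 2 by ring]
    have key : ∀ n, ∀ z ∈ ball z0 (r / 2),
        ‖(t n : ℂ)⁻¹ • (f (z + (t n : ℂ) • v) - f z) - fderiv ℂ f z v‖ ≤ t n * (C * ‖v‖ * ‖v‖) := by
      intro n z hz
      have hzs : z + (t n : ℂ) • v ∈ closedBall z (t n * ‖v‖) ∩ ball z0 r := by
        refine ⟨?_, hmem n z hz⟩
        rw [mem_closedBall, dist_eq_norm, add_sub_cancel_left, hnt]
      have := Convex.norm_image_sub_le_of_norm_fderiv_le' (𝕜 := ℂ) (f := f) (φ := fderiv ℂ f z) (C := C * (t n * ‖v‖))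
        (s := closedBall z (t n * ‖v‖) ∩ ball z0 r) (x := z) (y := z + (t n : ℂ) • v)
        (fun x hx => hd x (h14 hx.2))
        (fun x hx => by
          refine (hlip x hx.2 z (hh hz)).trans ?_
          gcongr
          have := hx.1
          rwa [mem_closedBall, dist_comm, dist_eq_norm] at this)
        ((convex_closedBall _ _).inter (convex_ball _ _))
        ⟨mem_closedBall_self (by have := (ht0 n).le; positivity), hh hz⟩ hzs
      rw [add_sub_cancel_left, hnt, map_smul] at this
      have htn : (t n : ℂ) ≠ 0 := by exact_mod_cast (ht0 n).ne'
      have e : (t n : ℂ)⁻¹ • (f (z + (t n : ℂ) • v) - f z) - fderiv ℂ f z v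
          = (t n : ℂ)⁻¹ • (f (z + (t n : ℂ) • v) - f z - (t n : ℂ) • fderiv ℂ f z v) := by
        rw [smul_sub (_ : ℂ) (_ - _), smul_smul, inv_mul_cancel₀ htn, one_smul]
      rw [e, norm_smul, norm_inv, Complex.norm_real, Real.norm_of_nonneg (ht0 n).le]
      rw [inv_mul_le_iff₀ (ht0 n)]
      refine this.trans_eq ?_
      ring
    rw [Metric.tendstoUniformlyOn_iff]
    intro ε hε
    have hl2 : Tendsto (fun n => t n * (C * ‖v‖ * ‖v‖)) atTop (𝓝 0) := by
      simpa using htl.mul_const (C * ‖v‖ * ‖v‖)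
    filter_upwards [hl2.eventually_lt_const hε] with n hn z hz
    rw [dist_comm, dist_eq_norm]
    exact (key n z hz).trans_lt hn

theorem holo_contDiffOn {E F : Type*} [NormedAddCommGroup E] [NormedSpace ℂ E] [FiniteDimensional ℂ E]
    [NormedAddCommGroup F] [NormedSpace ℂ F] [CompleteSpace F] {U : Set E} (hU : IsOpen U) (n : ℕ) :
    ∀ {f : E → F}, DifferentiableOn ℂ f U → ContDiffOn ℂ n f U := by
  induction n with
  | zero => intro f hf; exact contDiffOn_zero.2 hf.continuousOn
  | succ n ih =>
    intro f hf
    push_cast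
    rw [contDiffOn_succ_iff_fderiv_of_isOpen hU]
    refine ⟨hf, by simp, ?_⟩
    rw [contDiffOn_clm_apply]
    exact fun v => ih (dirDeriv_diff hU hf v)

theorem prod_diff {E ι : Type*} [NormedAddCommGroup E] [NormedSpace ℂ E] {s : Finset ι}
    {U : Set E} {f : ι → E → ℂ} (hf : ∀ i, DifferentiableOn ℂ (f i) U) :
    DifferentiableOn ℂ (fun z => ∏ i ∈ s, f i z) U := by
  classical
  induction s using Finset.induction_on with
  | empty => simp
  | insert a s ha ih =>
    simp only [Finset.prod_insert ha]
    exact (hf a).mul ih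

theorem det_diff {E : Type*} [NormedAddCommGroup E] [NormedSpace ℂ E] [FiniteDimensional ℂ E]
    {U : Set E} {f : E → E} (hU : IsOpen U) (hf : DifferentiableOn ℂ f U) :
    DifferentiableOn ℂ (fun z => LinearMap.det (fderiv ℂ f z : E →ₗ[ℂ] E)) U := by
  set b := Module.finBasis ℂ E
  have : (fun z => LinearMap.det (fderiv ℂ f z : E →ₗ[ℂ] E)) =
    fun z => ∑ σ : Equiv.Perm (Fin (Module.finrank ℂ E)), (Equiv.Perm.sign σ : ℤ) • 
      ∏ i, LinearMap.toMatrix b b (fderiv ℂ f z : E →ₗ[ℂ] E) (σ i) i := by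
    ext z
    rw [← LinearMap.det_toMatrix b, Matrix.det_apply]
    rfl
  rw [this]
  refine DifferentiableOn.fun_sum fun σ _ => ?_
  simp only [zsmul_eq_mul]
  refine DifferentiableOn.const_mul ?_ _
  refine prod_diff fun i => ?_
  simp only [LinearMap.toMatrix_apply]
  have h := dirDeriv_diff hU hf (b i)
  exact (LinearMap.toContinuousLinearMap (b.coord (σ i))).differentiable.comp_differentiableOn h

theorem hurwitz_zero {ι : Type*} {l : Filter ι} {g : ι → ℂ → ℂ} {G : ℂ → ℂ} {R : ℝ} (hR : 0 < R)
    (hg : ∀ᶠ i in l, DifferentiableOn ℂ (g i) (ball 0 R)) (hG : DifferentiableOn ℂ G (ball 0 R))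
    (h : ∀ ζ ∈ ball (0 : ℂ) R, Tendsto (fun p : ι × ℂ => g p.1 p.2) (l ×ˢ 𝓝 ζ) (𝓝 (G ζ)))
    (h0 : G 0 = 0) (hne : ¬ ∀ᶠ ζ in 𝓝 0, G ζ = 0) : ∀ᶠ i in l, ∃ ζ ∈ ball (0 : ℂ) R, g i ζ = 0 := by
  have hA : AnalyticAt ℂ G 0 := hG.analyticAt (ball_mem_nhds 0 hR)
  have h1 := hA.eventually_eq_zero_or_eventually_ne_zero.resolve_left hne
  rw [eventually_nhdsWithin_iff, Metric.eventually_nhds_iff_ball] at h1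
  obtain ⟨δ, hδ, h1⟩ := h1
  obtain ⟨r, hr, hrδ, hrR⟩ : ∃ r > 0, r < δ ∧ r < R :=
    ⟨min δ R / 2, by positivity, by have := min_le_left δ R; have : 0 < min δ R := by positivity
                                    linarith [min_le_left δ R],
      by have : 0 < min δ R := by positivity
         linarith [min_le_right δ R]⟩
  have hcb : closedBall (0 : ℂ) r ⊆ ball 0 R := closedBall_subset_ball hrR
  have hsp : sphere (0 : ℂ) r ⊆ ball 0 R := sphere_subset_closedBall.trans hcb
  have hGs : ∀ ζ ∈ sphere (0 : ℂ) r, G ζ ≠ 0 := fun ζ hζ => by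
    have hn : ‖ζ‖ = r := by simpa using hζ
    refine h1 ζ (by simpa [hn] using hrδ) ?_
    intro h; simp at h; rw [h] at hn; simp at hn; linarith
  obtain ⟨ε, hε, hmin⟩ : ∃ ε > 0, ∀ ζ ∈ sphere (0 : ℂ) r, ε < ‖G ζ‖ := by
    obtain ⟨ζ0, hζ0, hm⟩ := (isCompact_sphere (0 : ℂ) r).exists_isMinOn
      (NormedSpace.sphere_nonempty.2 hr.le) ((hG.continuousOn.mono hsp).norm)
    have hp := norm_pos_iff.2 (hGs ζ0 hζ0)
    refine ⟨‖G ζ0‖ / 2, by positivity, fun ζ hζ => ?_⟩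
    have : ‖G ζ0‖ ≤ ‖G ζ‖ := hm hζ
    linarith
  -- uniform lower bound on the sphere
  have h2 : ∀ᶠ i in l, ∀ ζ ∈ sphere (0 : ℂ) r, ε < ‖g i ζ‖ := by
    refine (isCompact_sphere (0 : ℂ) r).induction_on (p := fun s => ∀ᶠ i in l, ∀ ζ ∈ s, ε < ‖g i ζ‖)
      (by simp) ?_ ?_ ?_
    · intro s t hst ht
      filter_upwards [ht] with i hi ζ hζ using hi ζ (hst hζ)
    · intro s t hs ht
      filter_upwards [hs, ht] with i hi hi' ζ hζ
      exact hζ.elim (hi ζ) (hi' ζ)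
    · intro ζ hζ
      have := (h ζ (hsp hζ)).norm.eventually_const_lt (hmin ζ hζ)
      obtain ⟨p, hp, q, hq, hpq⟩ := eventually_prod_iff.1 this
      refine ⟨{x | q x}, mem_nhdsWithin_of_mem_nhds hq, ?_⟩
      filter_upwards [hp] with i hi ζ hζ using hpq hi hζ
  have h3 : ∀ᶠ i in l, ‖g i 0‖ < ε / 4 := by
    have : Tendsto (fun i => g i 0) l (𝓝 (G 0)) :=
      (h 0 (mem_ball_self hR)).comp (tendsto_id.prodMk (tendsto_const_nhds (x := (0 : ℂ))))
    rw [h0] at this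
    have := this.norm
    rw [norm_zero] at this
    exact this.eventually_lt_const (by positivity)
  filter_upwards [hg, h2, h3] with i hi h2 h3
  by_contra hcon
  push Not at hcon
  have hfreq : ∃ᶠ z in 𝓝 (0 : ℂ), g i z ≠ g i 0 := by
    intro hc
    have hc : ∀ᶠ z in 𝓝 (0 : ℂ), g i z = g i 0 := by
      filter_upwards [hc] with z hz; simpa using hz
    have hAn : AnalyticOnNhd ℂ (fun z => g i z - g i 0) (ball 0 R) :=
      (hi.sub_const _).analyticOnNhd isOpen_ball
    have := hAn.eqOn_zero_of_preconnected_of_eventuallyEq_zero (convex_ball _ _).isPreconnected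
      (mem_ball_self hR) (by filter_upwards [hc] with z hz; simp [hz])
    obtain ⟨ζ, hζ⟩ : (sphere (0 : ℂ) r).Nonempty := NormedSpace.sphere_nonempty.2 hr.le
    have h4 := this (hsp hζ)
    have h5 : g i ζ = g i 0 := by simpa [sub_eq_zero] using h4
    have := h2 ζ hζ
    rw [h5] at this
    linarith
  have := DiffContOnCl.ball_subset_image_closedBall (f := g i) (z₀ := 0) (r := r) (ε := ε / 2)
    (hi.diffContOnCl_ball hcb) hr
    (fun z hz => by
      have h5 := h2 z hz
      have := norm_sub_norm_le (g i z) (g i 0)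
      linarith) hfreq
  obtain ⟨ζ, hζ, hz⟩ := this (show (0 : ℂ) ∈ _ by
    rw [mem_ball, dist_comm, dist_zero_right]; linarith)
  exact hcon ζ (hcb hζ) hz


theorem proj_ker {E : Type*} [NormedAddCommGroup E] [NormedSpace ℂ E] (ℓ : E →L[ℂ] ℂ) (y : E) (hy : ℓ y ≠ 0) :
    ∃ P : E →L[ℂ] (LinearMap.ker ℓ.toLinearMap), ∀ z, (P z : E) = z - (ℓ z / ℓ y) • y := by
  refine ⟨(ContinuousLinearMap.id ℂ E - (ℓ.smulRight ((ℓ y)⁻¹ • y))).codRestrict _ ?_, ?_⟩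
  · intro z
    simp [LinearMap.mem_ker, hy]
  · intro z
    simp [smul_smul, div_eq_mul_inv]

theorem graph_lemma {E : Type*} [NormedAddCommGroup E] [NormedSpace ℂ E] [FiniteDimensional ℂ E]
    {U : Set E} (hU : IsOpen U) {u : E → ℂ} (hu : DifferentiableOn ℂ u U) {p v : E} (hp : p ∈ U)
    (L : E →L[ℂ] ℂ) (hL : HasFDerivAt u L p) (hv : L v ≠ 0) :
    ∃ γ : (LinearMap.ker L.toLinearMap) → E, ∃ ρ > 0, γ 0 = p ∧ DifferentiableOn ℂ γ (ball 0 ρ) ∧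
      InjOn γ (ball 0 ρ) ∧ MapsTo γ (ball 0 ρ) U ∧ (∀ κ ∈ ball 0 ρ, u (γ κ) = u p) ∧
      HasFDerivAt γ (LinearMap.ker L.toLinearMap).subtypeL 0 ∧
      ∃ N ∈ 𝓝 p, ∀ κ : LinearMap.ker L.toLinearMap, ∀ ζ : ℂ, p + κ + ζ • v ∈ N →
        u (p + κ + ζ • v) = u p → γ κ = p + κ + ζ • v := by
  have : CompleteSpace E := FiniteDimensional.complete ℂ E
  obtain ⟨P, hP⟩ := proj_ker L v hv
  have hPκ : ∀ κ : LinearMap.ker L.toLinearMap, P κ = κ := fun κ => by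
    ext
    have : L (κ : E) = 0 := κ.2
    rw [hP, this]; simp
  have hPv : P v = 0 := by
    ext; rw [hP]; simp [hv]
  let A : E ≃L[ℂ] ℂ × (LinearMap.ker L.toLinearMap) :=
    ContinuousLinearEquiv.equivOfInverse (L.prod P)
      ((ContinuousLinearMap.toSpanSingleton ℂ ((L v)⁻¹ • v)).coprod (LinearMap.ker L.toLinearMap).subtypeL)
      (fun z => by
        simp [hP, smul_smul, div_eq_mul_inv])
      (fun q => by
        obtain ⟨c, κ⟩ := q
        have : L (κ : E) = 0 := κ.2
        simp [hPκ, hPv, hv, this])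
  let Φ : E → ℂ × (LinearMap.ker L.toLinearMap) := fun z => (u z, P (z - p))
  have hΦ' : HasFDerivAt Φ (A : E →L[ℂ] ℂ × (LinearMap.ker L.toLinearMap)) p := by
    have h2 : HasFDerivAt (fun z => P (z - p)) P p := by
      have := P.hasFDerivAt (x := p - p)
      exact (hasFDerivAt_comp_sub _).2 this
    exact hL.prodMk h2
  have hΦc : ContDiffAt ℂ 1 Φ p := by
    have h1 : ContDiffAt ℂ 1 u p := by
      have := (holo_contDiffOn hU 1 hu).contDiffAt (hU.mem_nhds hp)
      exact_mod_cast this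
    exact h1.prodMk (P.contDiff.contDiffAt.comp p (contDiffAt_id.sub contDiffAt_const))
  let e := hΦc.toOpenPartialHomeomorph Φ hΦ' one_ne_zero
  have he : ∀ z, e z = Φ z := fun z => rfl
  have hps : p ∈ e.source := hΦc.mem_toOpenPartialHomeomorph_source hΦ' one_ne_zero
  have hΦp : Φ p = (u p, 0) := by simp [Φ]
  have hpt : (u p, (0 : LinearMap.ker L.toLinearMap)) ∈ e.target := by
    rw [← hΦp]; exact e.map_source hps
  have hsp : e.symm (u p, 0) = p := by
    rw [← hΦp]; exact e.left_inv hps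
  have hinv : ContDiffAt ℂ 1 e.symm (u p, 0) := by
    rw [← hΦp]; exact hΦc.to_localInverse hΦ' one_ne_zero
  have hderiv : HasFDerivAt e.symm (A.symm : ℂ × (LinearMap.ker L.toLinearMap) →L[ℂ] E) (u p, 0) := by
    apply e.hasFDerivAt_symm hpt
    rw [hsp]; exact hΦ'
  have hj : Continuous (fun κ : LinearMap.ker L.toLinearMap => (u p, κ)) := by fun_prop
  have hjd : ∀ κ, HasFDerivAt (fun κ : LinearMap.ker L.toLinearMap => (u p, κ))
      (ContinuousLinearMap.inr ℂ ℂ _) κ := fun κ => hasFDerivAt_prodMk_right _ _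
  have hev : ∀ᶠ q in 𝓝 (u p, (0 : LinearMap.ker L.toLinearMap)),
      q ∈ e.target ∧ DifferentiableAt ℂ e.symm q ∧ e.symm q ∈ U := by
    refine Eventually.and (e.open_target.mem_nhds hpt) (Eventually.and ?_ ?_)
    · filter_upwards [hinv.eventually (by simp)] with q hq using hq.differentiableAt one_ne_zero
    · apply hinv.continuousAt
      rw [hsp]; exact hU.mem_nhds hp
  have hev2 := (hj.tendsto 0).eventually hev
  obtain ⟨ρ, hρ, hball⟩ := Metric.eventually_nhds_iff_ball.1 hev2
  refine ⟨fun κ => e.symm (u p, κ), ρ, hρ, hsp, ?_, ?_, ?_, ?_, ?_, e.source, e.open_source.mem_nhds hps, ?_⟩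
  · intro κ hκ
    exact ((hball κ hκ).2.1.comp κ (hjd κ).differentiableAt).differentiableWithinAt
  · intro κ hκ κ' hκ' h
    have := e.symm.injOn (hball κ hκ).1 (hball κ' hκ').1 h
    exact (Prod.mk.inj this).2
  · exact fun κ hκ => (hball κ hκ).2.2
  · intro κ hκ
    have := e.right_inv (hball κ hκ).1
    rw [he] at this
    exact (Prod.mk.inj this).1
  · have := hderiv.comp (0 : LinearMap.ker L.toLinearMap) (hjd 0)
    have hA : (A.symm : ℂ × (LinearMap.ker L.toLinearMap) →L[ℂ] E).comp
        (ContinuousLinearMap.inr ℂ ℂ (LinearMap.ker L.toLinearMap)) =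
          (LinearMap.ker L.toLinearMap).subtypeL := by
      apply ContinuousLinearMap.ext
      intro κ
      apply A.injective
      change A (A.symm (0, κ)) = A (κ : E)
      rw [A.apply_symm_apply]
      have h0 : L (κ : E) = 0 := κ.2
      change _ = (L (κ : E), P (κ : E))
      rw [h0, hPκ]
    rw [hA] at this
    exact this
  · intro κ ζ hN hu0
    have h1 : Φ (p + κ + ζ • v) = (u p, κ) := by
      simp only [Φ, hu0]
      rw [add_assoc, add_sub_cancel_left, map_add, map_smul, hPv, hPκ]; simp
    change e.symm (u p, κ) = _
    rw [← h1]
    exact e.left_inv hN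

theorem line_hasDerivAt {E F : Type*} [NormedAddCommGroup E] [NormedSpace ℂ E]
    [NormedAddCommGroup F] [NormedSpace ℂ F] {f : E → F} {z v : E} {ζ : ℂ}
    (hf : DifferentiableAt ℂ f (z + ζ • v)) :
    HasDerivAt (fun ζ : ℂ => f (z + ζ • v)) (fderiv ℂ f (z + ζ • v) v) ζ := by
  have hl : HasDerivAt (fun ζ : ℂ => z + ζ • v) v ζ := by
    simpa using ((hasDerivAt_id ζ).smul_const v).const_add z
  exact hf.hasFDerivAt.comp_hasDerivAt ζ hl

/-- Directional derivative operator. -/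
noncomputable def dirD {E : Type*} [NormedAddCommGroup E] [NormedSpace ℂ E] (v : E) (h : E → ℂ) : E → ℂ :=
  fun z => fderiv ℂ h z v

theorem dirD_iter_diff {E : Type*} [NormedAddCommGroup E] [NormedSpace ℂ E] {U : Set E} (hU : IsOpen U)
    (v : E) {h : E → ℂ} (hh : DifferentiableOn ℂ h U) (j : ℕ) : DifferentiableOn ℂ ((dirD v)^[j] h) U := by
  induction j with
  | zero => exact hh
  | succ j ih =>
    rw [Function.iterate_succ_apply']
    exact dirDeriv_diff hU ih v

theorem dirD_iter_eq {E : Type*} [NormedAddCommGroup E] [NormedSpace ℂ E] {U : Set E} (hU : IsOpen U)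
    (v p : E) (hp : p ∈ U) (j : ℕ) : ∀ {h : E → ℂ}, DifferentiableOn ℂ h U →
      iteratedDeriv j (fun ζ : ℂ => h (p + ζ • v)) 0 = ((dirD v)^[j] h) p := by
  induction j with
  | zero => intro h hh; simp
  | succ j ih =>
    intro h hh
    rw [iteratedDeriv_succ', Function.iterate_succ_apply, ← ih (h := dirD v h) (dirDeriv_diff hU hh v)]
    apply Filter.EventuallyEq.iteratedDeriv_eq
    have hc : Continuous (fun ζ : ℂ => p + ζ • v) := by fun_prop
    have : ∀ᶠ ζ in 𝓝 (0 : ℂ), p + ζ • v ∈ U :=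
      hc.continuousAt (hU.mem_nhds (by simpa using hp))
    filter_upwards [this] with ζ hζ
    exact (line_hasDerivAt ((hh _ hζ).differentiableAt (hU.mem_nhds hζ))).deriv

theorem dirD_iter_iff {E : Type*} [NormedAddCommGroup E] [NormedSpace ℂ E] {U : Set E} (hU : IsOpen U)
    (v p : E) (hp : p ∈ U) {h : E → ℂ} (hh : DifferentiableOn ℂ h U) :
    (∀ᶠ ζ in 𝓝 (0 : ℂ), h (p + ζ • v) = 0) ↔ ∀ j, ((dirD v)^[j] h) p = 0 := by
  have hc : Continuous (fun ζ : ℂ => p + ζ • v) := by fun_prop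
  have hU' : ∀ᶠ ζ in 𝓝 (0 : ℂ), p + ζ • v ∈ U :=
    hc.continuousAt (hU.mem_nhds (by simpa using hp))
  have hA : AnalyticAt ℂ (fun ζ : ℂ => h (p + ζ • v)) 0 := by
    apply DifferentiableOn.analyticAt (s := (fun ζ : ℂ => p + ζ • v) ⁻¹' U) _ hU'
    intro ζ hζ
    exact (line_hasDerivAt ((hh _ hζ).differentiableAt (hU.mem_nhds hζ))).differentiableAt.differentiableWithinAt
  rw [← analyticOrderAt_eq_top]
  constructor
  · intro ht j
    rw [← dirD_iter_eq hU v p hp j hh]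
    exact (natCast_le_analyticOrderAt_iff_iteratedDeriv_eq_zero hA (n := j + 1)).1 (by rw [ht]; exact le_top) j (by simp)
  · intro hj
    rw [ENat.eq_top_iff_forall_ge]
    intro n
    rw [natCast_le_analyticOrderAt_iff_iteratedDeriv_eq_zero hA]
    intro i _
    rw [dirD_iter_eq hU v p hp i hh]
    exact hj i

theorem inj_deriv_one {g : ℂ → ℂ} {R : ℝ} (hR : 0 < R) (hg : DifferentiableOn ℂ g (ball 0 R))
    (hi : InjOn g (ball 0 R)) : deriv g 0 ≠ 0 := by
  intro h0
  have hR2 : 0 < R / 2 := by positivity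
  have hsub : ball (0 : ℂ) (R / 2) ⊆ ball 0 R := ball_subset_ball (by linarith)
  have hadd : ∀ c ∈ ball (0 : ℂ) (R / 2), ∀ ζ ∈ ball (0 : ℂ) (R / 2), ζ + c ∈ ball (0 : ℂ) R := by
    intro c hc ζ hζ
    rw [mem_ball_zero_iff] at *
    linarith [norm_add_le ζ c]
  have hdiff : ∀ ζ ∈ ball (0 : ℂ) R, DifferentiableAt ℂ g ζ := fun ζ hζ =>
    (hg ζ hζ).differentiableAt (isOpen_ball.mem_nhds hζ)
  have hsmall : ∀ᶠ c in 𝓝[≠] (0 : ℂ), c ∈ ball (0 : ℂ) (R / 2) :=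
    mem_nhdsWithin_of_mem_nhds (ball_mem_nhds _ hR2)
  by_cases hne : ∀ᶠ ζ in 𝓝 (0 : ℂ), deriv g ζ = 0
  · obtain ⟨δ, hδ, hball⟩ := Metric.eventually_nhds_iff_ball.1 (hne.and (ball_mem_nhds (0 : ℂ) hR))
    have hconst := fun y hy => IsOpen.is_const_of_deriv_eq_zero (𝕜 := ℂ) (f := g) (s := ball 0 δ) isOpen_ball
      (convex_ball (0 : ℂ) δ).isPreconnected (fun x hx => (hdiff x (hball x hx).2).differentiableWithinAt)
      (fun x hx => (hball x hx).1) (x := (0 : ℂ)) (y := y) (mem_ball_self hδ) hy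
    have hm : ((δ / 2 : ℝ) : ℂ) ∈ ball (0 : ℂ) δ := by
      rw [mem_ball_zero_iff, Complex.norm_real, Real.norm_of_nonneg (by positivity)]; linarith
    have := hi (mem_ball_self hR) (hball _ hm).2 (hconst _ hm)
    have h2 : (δ / 2 : ℝ) = 0 := by exact_mod_cast this.symm
    linarith
  have hz := hurwitz_zero (l := 𝓝[≠] (0 : ℂ)) (g := fun c ζ => c⁻¹ * (g (ζ + c) - g ζ)) (G := deriv g) hR2
    (by
      filter_upwards [hsmall] with c hc ζ hζ
      have h1 := (hdiff _ (hadd c hc ζ hζ))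
      have h2 : DifferentiableAt ℂ (fun ζ => g (ζ + c)) ζ := by
        exact DifferentiableAt.comp ζ (f := fun ζ => ζ + c) h1 (by fun_prop)
      exact ((h2.sub (hdiff ζ (hsub hζ))).const_mul _).differentiableWithinAt)
    ((hg.deriv isOpen_ball).mono hsub)
    (by
      intro ζ hζ
      have hs : HasStrictDerivAt g (deriv g ζ) ζ :=
        (hg.analyticAt (isOpen_ball.mem_nhds (hsub hζ))).hasStrictDerivAt
      have hlo := hs.isLittleO
      rw [Metric.tendsto_nhds]
      intro ε hε
      have h1 := hlo.def (half_pos hε)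
      have ht : Tendsto (fun q : ℂ × ℂ => (q.2 + q.1, q.2)) (𝓝[≠] 0 ×ˢ 𝓝 ζ) (𝓝 (ζ, ζ)) := by
        have hc : Continuous (fun q : ℂ × ℂ => (q.2 + q.1, q.2)) := by fun_prop
        have := hc.tendsto (0, ζ)
        simp only [add_zero] at this
        refine this.mono_left ?_
        rw [nhds_prod_eq]
        exact Filter.prod_mono nhdsWithin_le_nhds le_rfl
      have h3 : ∀ᶠ q : ℂ × ℂ in 𝓝[≠] 0 ×ˢ 𝓝 ζ, q.1 ≠ 0 :=
        tendsto_fst.eventually (self_mem_nhdsWithin)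
      filter_upwards [ht.eventually h1, h3] with q hq hq0
      simp only [add_sub_cancel_left, ContinuousLinearMap.toSpanSingleton_apply] at hq
      rw [dist_eq_norm]
      have e : q.1⁻¹ * (g (q.2 + q.1) - g q.2) - deriv g ζ
          = q.1⁻¹ * (g (q.2 + q.1) - g q.2 - q.1 • deriv g ζ) := by
        rw [smul_eq_mul]; field_simp
      rw [e, norm_mul, norm_inv]
      have hqp := norm_pos_iff.2 hq0
      rw [inv_mul_lt_iff₀ hqp]
      nlinarith)
    h0 hne
  obtain ⟨c, ⟨ζ, hζ, hzero⟩, hc, hc0⟩ := (hz.and (hsmall.and self_mem_nhdsWithin)).exists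
  have hc0 : c ≠ 0 := hc0
  have : g (ζ + c) = g ζ := by
    simpa [hc0, sub_eq_zero] using hzero
  have := hi (hadd c hc ζ hζ) (hsub hζ) this
  simp at this
  exact hc0 this

theorem inj_ker_step {E : Type*} [NormedAddCommGroup E] [NormedSpace ℂ E] [FiniteDimensional ℂ E]
    (n : ℕ) (hn : Module.finrank ℂ E = n + 1)
    (IH : ∀ (K : Submodule ℂ E), Module.finrank ℂ K = n → ∀ (f : K → K) (U : Set K), IsOpen U →
      DifferentiableOn ℂ f U → InjOn f U → ∀ a ∈ U, ∀ w, fderiv ℂ f a w = 0 → w = 0)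
    {f : E → E} {U : Set E} (hU : IsOpen U) (hf : DifferentiableOn ℂ f U) (hi : InjOn f U) {a : E} (ha : a ∈ U)
    (hne : fderiv ℂ f a ≠ 0) (w : E) (hw : fderiv ℂ f a w = 0) : w = 0 := by
  obtain ⟨v, hv⟩ : ∃ v, fderiv ℂ f a v ≠ 0 := by
    by_contra hcon
    push Not at hcon
    exact hne (ContinuousLinearMap.ext hcon)
  obtain ⟨ℓ, hℓ⟩ := SeparatingDual.exists_ne_zero (R := ℂ) hv
  have hfa : HasFDerivAt f (fderiv ℂ f a) a := ((hf a ha).differentiableAt (hU.mem_nhds ha)).hasFDerivAt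
  let L : E →L[ℂ] ℂ := ℓ.comp (fderiv ℂ f a)
  have hL : HasFDerivAt (fun z => ℓ (f z)) L a := ℓ.hasFDerivAt.comp a hfa
  have hLv : L v ≠ 0 := hℓ
  obtain ⟨γ, ρ, hρ, hγ0, hγd, hγi, hγU, hγu, hγ', -⟩ := graph_lemma hU
    (u := fun z => ℓ (f z)) (ℓ.differentiable.comp_differentiableOn hf) ha L hL hLv
  obtain ⟨P, hP⟩ := proj_ker ℓ _ hℓ
  have hPk : ∀ y, ℓ y = 0 → (P y : E) = y := fun y hy => by rw [hP, hy]; simp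
  have hd1 : Module.finrank ℂ (LinearMap.ker L.toLinearMap) = n := by
    have := Module.Dual.finrank_ker_add_one_of_ne_zero (f := L.toLinearMap) (by
      intro h; exact hLv (by simpa using LinearMap.congr_fun h v))
    omega
  have hd2 : Module.finrank ℂ (LinearMap.ker ℓ.toLinearMap) = n := by
    have := Module.Dual.finrank_ker_add_one_of_ne_zero (f := ℓ.toLinearMap) (by
      intro h; exact hℓ (by simpa using LinearMap.congr_fun h (fderiv ℂ f a v)))
    omega
  let e : (LinearMap.ker ℓ.toLinearMap) ≃L[ℂ] (LinearMap.ker L.toLinearMap) :=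
    ContinuousLinearEquiv.ofFinrankEq (hd2.trans hd1.symm)
  let Q : E →L[ℂ] (LinearMap.ker L.toLinearMap) :=
    (e : (LinearMap.ker ℓ.toLinearMap) →L[ℂ] (LinearMap.ker L.toLinearMap)).comp P
  have hQ : ∀ y, Q y = e (P y) := fun y => rfl
  have hfγ : DifferentiableOn ℂ (fun κ => f (γ κ)) (ball 0 ρ) := hf.comp hγd hγU
  have key := IH (LinearMap.ker L.toLinearMap) hd1 (fun κ => Q (f (γ κ) - f a)) (ball 0 ρ) isOpen_ball
    (Q.differentiable.comp_differentiableOn (hfγ.sub_const _))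
    (by
      intro κ hκ κ' hκ' h
      have h1 : P (f (γ κ) - f a) = P (f (γ κ') - f a) := e.injective h
      have h2 := congrArg (fun x : LinearMap.ker ℓ.toLinearMap => (x : E)) h1
      rw [hPk _ (by rw [map_sub, hγu κ hκ, sub_self]), hPk _ (by rw [map_sub, hγu κ' hκ', sub_self])] at h2
      have h3 : f (γ κ) = f (γ κ') := by simpa using h2
      exact hγi hκ hκ' (hi (hγU hκ) (hγU hκ') h3))
    0 (mem_ball_self hρ)
  have hder : HasFDerivAt (fun κ => Q (f (γ κ) - f a))
      (Q.comp ((fderiv ℂ f a).comp (LinearMap.ker L.toLinearMap).subtypeL)) 0 := by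
    rw [← hγ0] at hfa
    have h1 := hfa.comp (0 : LinearMap.ker L.toLinearMap) hγ'
    rw [hγ0] at h1
    exact Q.hasFDerivAt.comp (0 : LinearMap.ker L.toLinearMap) (h1.sub_const (f a))
  have hwK : L w = 0 := by simp [L, hw]
  have := key ⟨w, hwK⟩ (by
    rw [hder.fderiv]
    simp [hw])
  exact congrArg Subtype.val this

theorem const_contra {E F : Type*} [NormedAddCommGroup E] [NormedSpace ℂ E] [Nontrivial E]
    [NormedAddCommGroup F] [NormedSpace ℂ F] {f : E → F} {a : E} {U : Set E} (hU : U ∈ 𝓝 a)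
    (hd : ∀ᶠ z in 𝓝 a, HasFDerivAt f (0 : E →L[ℂ] F) z) (hi : InjOn f U) : False := by
  let _ : NormedSpace ℝ E := NormedSpace.restrictScalars ℝ ℂ E
  obtain ⟨δ, hδ, hball⟩ := Metric.eventually_nhds_iff_ball.1 (hd.and hU)
  have : ∃ y ∈ ball a δ, y ≠ a := by
    obtain ⟨w, hw⟩ := exists_ne (0 : E)
    have hw' := norm_pos_iff.2 hw
    refine ⟨a + ((δ / 2 / ‖w‖ : ℝ) : ℂ) • w, ?_, ?_⟩
    · rw [mem_ball, dist_eq_norm, add_sub_cancel_left, norm_smul, Complex.norm_real,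
        Real.norm_of_nonneg (by positivity), div_mul_cancel₀ _ hw'.ne']
      linarith
    · intro h
      have : ((δ / 2 / ‖w‖ : ℝ) : ℂ) • w = 0 := by simpa using h
      rcases smul_eq_zero.1 this with h | h
      · have h' : δ / 2 / ‖w‖ = 0 := by exact_mod_cast h
        have : 0 < δ / 2 / ‖w‖ := by positivity
        linarith
      · exact hw h
  obtain ⟨y, hy, hya⟩ := this
  have hc := IsOpen.is_const_of_fderiv_eq_zero (𝕜 := ℂ) (f := f) (s := ball a δ) isOpen_ball
    (convex_ball a δ).isPreconnected
    (fun x hx => (hball x hx).1.differentiableAt.differentiableWithinAt)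
    (fun x hx => (hball x hx).1.fderiv) hy (mem_ball_self hδ)
  exact hya (hi (hball y hy).2 (hball a (mem_ball_self hδ)).2 hc)

theorem line_not_ev_zero {E : Type*} [NormedAddCommGroup E] [NormedSpace ℂ E] {h : E → ℂ} {a w : E} {ρ : ℝ}
    (hw : w ∈ ball a ρ) (hh : DifferentiableOn ℂ h (ball a ρ)) (hne : h w ≠ 0) :
    ¬ ∀ᶠ ζ in 𝓝 (0 : ℂ), h (a + ζ • (w - a)) = 0 := by
  intro hev
  let V : Set ℂ := (fun ζ : ℂ => a + ζ • (w - a)) ⁻¹' ball a ρ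
  have hc : Continuous (fun ζ : ℂ => a + ζ • (w - a)) := by fun_prop
  have hV : IsOpen V := isOpen_ball.preimage hc
  have hVm : ∀ ζ, ζ ∈ V ↔ ‖ζ‖ * ‖w - a‖ < ρ := fun ζ => by
    simp [V, mem_ball, dist_eq_norm, norm_smul]
  have hVc : IsPreconnected V := by
    refine Convex.isPreconnected ?_
    intro x hx y hy s t hs ht hst
    rw [hVm] at *
    have h1 : ‖s • x + t • y‖ ≤ s * ‖x‖ + t * ‖y‖ := by
      refine (norm_add_le _ _).trans ?_
      rw [norm_smul, norm_smul, Real.norm_of_nonneg hs, Real.norm_of_nonneg ht]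
    have hn := norm_nonneg (w - a)
    have h2 : (s * ‖x‖ + t * ‖y‖) * ‖w - a‖ < ρ := by
      have : s * (‖x‖ * ‖w - a‖) + t * (‖y‖ * ‖w - a‖) < ρ := by
        rcases hs.eq_or_lt with h | h
        · subst h
          have : t = 1 := by linarith
          subst this; linarith
        · have ha1 := mul_lt_mul_of_pos_left hx h
          have ha2 := mul_le_mul_of_nonneg_left hy.le ht
          have : s * ρ + t * ρ = ρ := by rw [← add_mul, hst, one_mul]
          linarith
      linarith
    exact (mul_le_mul_of_nonneg_right h1 hn).trans_lt h2
  have hρ : 0 < ρ := dist_nonneg.trans_lt hw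
  have hA : AnalyticOnNhd ℂ (fun ζ : ℂ => h (a + ζ • (w - a))) V := by
    apply DifferentiableOn.analyticOnNhd _ hV
    intro ζ hζ
    exact (line_hasDerivAt ((hh _ hζ).differentiableAt (isOpen_ball.mem_nhds hζ))).differentiableAt.differentiableWithinAt
  have := hA.eqOn_zero_of_preconnected_of_eventuallyEq_zero hVc (z₀ := 0) ((hVm 0).2 (by simpa using hρ)) hev
  have h1 := this (x := 1) ((hVm 1).2 (by simpa [dist_eq_norm] using hw))
  apply hne
  simpa using h1

theorem osgood_inj (n : ℕ) : ∀ {E : Type} [NormedAddCommGroup E] [NormedSpace ℂ E] [FiniteDimensional ℂ E]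
    (_ : Module.finrank ℂ E = n) (f : E → E) (U : Set E), IsOpen U →
      DifferentiableOn ℂ f U → InjOn f U → ∀ a ∈ U, ∀ w, fderiv ℂ f a w = 0 → w = 0 := by
  induction n with
  | zero =>
    intro E _ _ _ hn f U _ _ _ a _ w _
    have := Module.finrank_zero_iff.1 hn
    exact Subsingleton.elim _ _
  | succ n IH =>
    intro E _ _ _ hn f U hU hf hi a ha w hw
    have hdf : ∀ z ∈ U, HasFDerivAt f (fderiv ℂ f z) z := fun z hz =>
      ((hf z hz).differentiableAt (hU.mem_nhds hz)).hasFDerivAt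
    by_contra hw0
    rcases Nat.eq_zero_or_pos n with h0 | hnpos
    · -- dimension one
      subst h0
      let e : E ≃L[ℂ] ℂ := ContinuousLinearEquiv.ofFinrankEq (by simp [hn])
      have hc : Continuous (fun ζ : ℂ => a + ζ • w) := by fun_prop
      have hev : ∀ᶠ ζ in 𝓝 (0 : ℂ), a + ζ • w ∈ U := hc.continuousAt (hU.mem_nhds (by simpa using ha))
      obtain ⟨R, hR, hball⟩ := Metric.eventually_nhds_iff_ball.1 hev
      have hD : ∀ ζ ∈ ball (0 : ℂ) R, HasDerivAt (fun ζ : ℂ => e (f (a + ζ • w))) (e (fderiv ℂ f (a + ζ • w) w)) ζ := by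
        intro ζ hζ
        exact e.hasFDerivAt.comp_hasDerivAt ζ (line_hasDerivAt (hdf _ (hball ζ hζ)).differentiableAt)
      refine inj_deriv_one (g := fun ζ : ℂ => e (f (a + ζ • w))) hR
        (fun ζ hζ => (hD ζ hζ).differentiableAt.differentiableWithinAt) ?_ ?_
      · intro ζ hζ ζ' hζ' h
        have := hi (hball ζ hζ) (hball ζ' hζ') (e.injective h)
        exact smul_left_injective ℂ hw0 (add_left_cancel this)
      · rw [(hD 0 (mem_ball_self hR)).deriv]
        simp [hw]
    have hstep : ∀ z ∈ U, fderiv ℂ f z ≠ 0 → ∀ w, fderiv ℂ f z w = 0 → w = 0 := fun z hz hne w hw =>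
      inj_ker_step n hn (fun K hK f U => IH hK f U) hU hf hi hz hne w hw
    set h : E → ℂ := fun z => LinearMap.det (fderiv ℂ f z : E →ₗ[ℂ] E) with hh
    have hhd : DifferentiableOn ℂ h U := det_diff hU hf
    have hZ : ∀ z ∈ U, h z = 0 → fderiv ℂ f z = 0 := by
      intro z hz hz0
      by_contra hne
      refine LinearMap.det_eq_zero_iff_ker_ne_bot.1 hz0 ?_
      rw [LinearMap.ker_eq_bot']
      exact hstep z hz hne
    have ha0 : h a = 0 := by
      refine LinearMap.det_eq_zero_iff_ker_ne_bot.2 fun hb => hw0 ?_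
      rw [LinearMap.ker_eq_bot'] at hb
      exact hb w hw
    have hnt : Nontrivial E := ⟨w, 0, hw0⟩
    by_cases hev : ∀ᶠ z in 𝓝 a, h z = 0
    · refine const_contra (hU.mem_nhds ha) ?_ hi
      filter_upwards [hev, hU.mem_nhds ha] with z hz hzU
      have := hdf z hzU
      rwa [hZ z hzU hz] at this
    obtain ⟨ρ, hρ, hρU⟩ := Metric.isOpen_iff.1 hU a ha
    obtain ⟨w', hw', hne⟩ : ∃ w' ∈ ball a ρ, h w' ≠ 0 := by
      by_contra hcon
      push Not at hcon
      exact hev (by filter_upwards [ball_mem_nhds a hρ] with z hz using hcon z hz)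
    have hnz := line_not_ev_zero hw' (hhd.mono hρU) hne
    set v := w' - a
    have hex : ∃ k, ∃ p ∈ U, h p = 0 ∧ ((dirD v)^[k] h) p ≠ 0 := by
      rw [dirD_iter_iff hU v a ha hhd] at hnz
      push Not at hnz
      obtain ⟨j, hj⟩ := hnz
      exact ⟨j, a, ha, ha0, hj⟩
    classical
    obtain ⟨p, hp, hp0, hpk⟩ := Nat.find_spec hex
    have hmin : ∀ j < Nat.find hex, ∀ z ∈ U, h z = 0 → ((dirD v)^[j] h) z = 0 := by
      intro j hj z hz hz0
      by_contra hcon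
      exact Nat.find_min hex hj ⟨z, hz, hz0, hcon⟩
    generalize Nat.find hex = k at hpk hmin
    rcases k with _ | j
    · exact hpk hp0
    have hnzp : ¬ ∀ᶠ ζ in 𝓝 (0 : ℂ), h (p + ζ • v) = 0 := by
      rw [dirD_iter_iff hU v p hp hhd]
      intro hall; exact hpk (hall _)
    set u := (dirD v)^[j] h with hu
    have hud : DifferentiableOn ℂ u U := dirD_iter_diff hU v hhd j
    have huZ : ∀ z ∈ U, h z = 0 → u z = 0 := hmin j (by simp)
    rw [Function.iterate_succ_apply'] at hpk
    have huv : fderiv ℂ u p v ≠ 0 := hpk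
    have hud' := ((hud p hp).differentiableAt (hU.mem_nhds hp)).hasFDerivAt
    have hgl := graph_lemma hU hud hp (fderiv ℂ u p) hud' huv
    obtain ⟨K, hK⟩ : ∃ K, K = LinearMap.ker (fderiv ℂ u p).toLinearMap := ⟨_, rfl⟩
    rw [← hK] at hgl
    obtain ⟨γ, ρ', hρ', hγ0, hγd, hγi, hγU, hγu, hγ', N, hN, hgraph⟩ := hgl
    have hdK : Module.finrank ℂ K = n := by
      have := Module.Dual.finrank_ker_add_one_of_ne_zero (f := (fderiv ℂ u p).toLinearMap) (by
        intro h; exact huv (by simpa using LinearMap.congr_fun h v))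
      rw [← hK] at this
      omega
    have hKnt : Nontrivial K := Module.nontrivial_of_finrank_pos (R := ℂ) (by omega)
    have hcc : Continuous (fun q : K × ℂ => p + (q.1 : E) + q.2 • v) := by fun_prop
    have hevN : ∀ᶠ q in 𝓝 ((0 : K), (0 : ℂ)), p + (q.1 : E) + q.2 • v ∈ N ∩ U := by
      apply hcc.continuousAt
      simpa using inter_mem hN (hU.mem_nhds hp)
    rw [nhds_prod_eq] at hevN
    obtain ⟨P1, hP1, P2, hP2, hP12⟩ := eventually_prod_iff.1 hevN
    obtain ⟨R, hR, hRP⟩ := Metric.eventually_nhds_iff_ball.1 hP2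
    have hP10 : P1 0 := hP1.self_of_nhds
    have hlined : ∀ κ : K, P1 κ → DifferentiableOn ℂ (fun ζ : ℂ => h (p + (κ : E) + ζ • v)) (ball 0 R) := by
      intro κ hκ ζ hζ
      have hm := (hP12 hκ (hRP ζ hζ)).2
      exact (line_hasDerivAt ((hhd _ hm).differentiableAt (hU.mem_nhds hm))).differentiableAt.differentiableWithinAt
    have hz := hurwitz_zero (l := 𝓝 (0 : K)) (g := fun κ ζ => h (p + (κ : E) + ζ • v)) (G := fun ζ => h (p + ζ • v)) hR
      (by filter_upwards [hP1] with κ hκ using hlined κ hκ)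
      (by simpa using hlined 0 hP10)
      (by
        intro ζ hζ
        have hm := (hP12 hP10 (hRP ζ hζ)).2
        have hcont := (hhd _ hm).differentiableAt (hU.mem_nhds hm) |>.continuousAt
        have h1 : Tendsto (fun q : K × ℂ => h (p + (q.1 : E) + q.2 • v)) (𝓝 (0, ζ)) (𝓝 (h (p + ((0 : K) : E) + ζ • v))) :=
          hcont.tendsto.comp (hcc.tendsto (0, ζ))
        rw [nhds_prod_eq] at h1
        simpa using h1)
      (by simpa using hp0) hnzp
    have hzero : ∀ᶠ κ in 𝓝 (0 : K), fderiv ℂ f (γ κ) = 0 := by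
      filter_upwards [hz, hP1] with κ hκ hκ1
      obtain ⟨ζ, hζ, hζ0⟩ := hκ
      have hm := hP12 hκ1 (hRP ζ hζ)
      have h1 := hgraph κ ζ hm.1 (by rw [huZ _ hm.2 hζ0, huZ p hp hp0])
      rw [h1]
      exact hZ _ hm.2 hζ0
    refine const_contra (E := K) (f := fun κ => f (γ κ)) (a := 0) (U := ball 0 ρ') (ball_mem_nhds _ hρ') ?_ ?_
    · filter_upwards [hzero, ball_mem_nhds (0 : K) hρ'] with κ hκ hκb
      have h1 := hdf _ (hγU hκb)
      rw [hκ] at h1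
      have h2 := ((hγd κ hκb).differentiableAt (isOpen_ball.mem_nhds hκb)).hasFDerivAt
      have h3 := h1.comp κ h2
      rwa [ContinuousLinearMap.zero_comp] at h3
    · intro κ hκ κ' hκ' hee
      exact hγi hκ hκ' (hi (hγU hκ) (hγU hκ') hee)

theorem osgood_det {E : Type} [NormedAddCommGroup E] [NormedSpace ℂ E] [FiniteDimensional ℂ E]
    {f : E → E} {U : Set E} (hU : IsOpen U) (hf : DifferentiableOn ℂ f U) (hi : InjOn f U) {a : E} (ha : a ∈ U) :
    LinearMap.det (fderiv ℂ f a : E →ₗ[ℂ] E) ≠ 0 := by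
  intro h
  refine LinearMap.det_eq_zero_iff_ker_ne_bot.1 h ?_
  rw [LinearMap.ker_eq_bot']
  exact osgood_inj _ rfl f U hU hf hi a ha


theorem fderiv_conv {E F : Type*} [NormedAddCommGroup E] [NormedSpace ℂ E] [FiniteDimensional ℂ E]
    [NormedAddCommGroup F] [NormedSpace ℂ F] [CompleteSpace F]
    {U : Set E} (hU : IsOpen U) {φ : ℕ → E → F} {ψ : E → F} (hφ : ∀ k, DifferentiableOn ℂ (φ k) U)
    (hψ : DifferentiableOn ℂ ψ U) (hconv : TendstoLocallyUniformlyOn φ ψ atTop U) {z₀ : E} (hz : z₀ ∈ U) :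
    Tendsto (fun q : ℕ × E => fderiv ℂ (φ q.1) q.2) (atTop ×ˢ 𝓝 z₀) (𝓝 (fderiv ℂ ψ z₀)) := by
  have hcont : ContinuousAt (fderiv ℂ ψ) z₀ :=
    ((holo_contDiffOn hU 1 hψ).continuousOn_fderiv_of_isOpen hU (by simp)).continuousAt (hU.mem_nhds hz)
  rw [Metric.tendsto_nhds]
  intro ε hε
  have hc := Metric.tendsto_nhds.1 hcont.tendsto (ε / 2) (by positivity)
  obtain ⟨ρ, hρ, hρU⟩ := Metric.isOpen_iff.1 hU z₀ hz
  -- the radius is fixed by a first application of local uniform convergence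
  have hsmall : ∃ r > 0, ∀ δ > 0, ∀ᶠ k in atTop, ∀ w ∈ ball z₀ (2 * r), w ∈ U ∧ ‖φ k w - ψ w‖ < δ := by
    have : ProperSpace E := FiniteDimensional.proper ℂ E
    refine ⟨ρ / 4, by positivity, fun δ hδ => ?_⟩
    have hcomp := (tendstoLocallyUniformlyOn_iff_forall_isCompact hU).1 hconv (closedBall z₀ (ρ / 2))
      ((closedBall_subset_ball (by linarith)).trans hρU) (isCompact_closedBall _ _)
    filter_upwards [Metric.tendstoUniformlyOn_iff.1 hcomp δ hδ] with k hk w hw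
    have hw' : w ∈ closedBall z₀ (ρ / 2) := by
      rw [mem_closedBall]; rw [mem_ball] at hw; linarith
    refine ⟨hρU (closedBall_subset_ball (by linarith) hw'), ?_⟩
    rw [← dist_eq_norm, dist_comm]
    exact hk w hw'
  obtain ⟨r, hr, hk⟩ := hsmall
  have hk' := hk (ε / 2 * (r / 2)) (by positivity)
  refine ((hk'.prod_mk (hc.and (ball_mem_nhds z₀ hr)))).mono ?_
  rintro ⟨k, z⟩ ⟨h1, h2, h3⟩
  simp only at h1 h2 h3 ⊢
  have hsub : ∀ w ∈ closedBall z (r / 2), w ∈ ball z₀ (2 * r) := by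
    intro w hw
    rw [mem_ball] at *
    rw [mem_closedBall] at hw
    linarith [dist_triangle w z z₀]
  have hd : ∀ w ∈ U, ∀ k, DifferentiableAt ℂ (φ k) w := fun w hw k => (hφ k w hw).differentiableAt (hU.mem_nhds hw)
  have hd' : ∀ w ∈ U, DifferentiableAt ℂ ψ w := fun w hw => (hψ w hw).differentiableAt (hU.mem_nhds hw)
  have hb := cauchy_fderiv (f := fun w => φ k w - ψ w) (z := z) (r := r / 2) (M := ε / 2 * (r / 2)) (by positivity)
    (fun w hw => (hd w (h1 w (hsub w hw)).1 k).sub (hd' w (h1 w (hsub w hw)).1))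
    (fun w hw => (h1 w (hsub w hw)).2.le)
  have hzU := (h1 z (hsub z (mem_closedBall_self (by positivity)))).1
  rw [show (fun w => φ k w - ψ w) = φ k - ψ from rfl, fderiv_sub (hd z hzU k) (hd' z hzU),
    mul_div_cancel_right₀ _ (by positivity), ← dist_eq_norm] at hb
  linarith [dist_triangle (fderiv ℂ (φ k) z) (fderiv ℂ ψ z) (fderiv ℂ ψ z₀)]

theorem det_conv {E : Type*} [NormedAddCommGroup E] [NormedSpace ℂ E] [FiniteDimensional ℂ E]
    {U : Set E} (hU : IsOpen U) {φ : ℕ → E → E} {ψ : E → E} (hφ : ∀ k, DifferentiableOn ℂ (φ k) U)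
    (hψ : DifferentiableOn ℂ ψ U) (hconv : TendstoLocallyUniformlyOn φ ψ atTop U) {z₀ : E} (hz : z₀ ∈ U) :
    Tendsto (fun q : ℕ × E => LinearMap.det (fderiv ℂ (φ q.1) q.2 : E →ₗ[ℂ] E)) (atTop ×ˢ 𝓝 z₀)
      (𝓝 (LinearMap.det (fderiv ℂ ψ z₀ : E →ₗ[ℂ] E))) := by
  have : CompleteSpace E := FiniteDimensional.complete ℂ E
  exact (ContinuousLinearMap.continuous_det.tendsto _).comp (fderiv_conv hU hφ hψ hconv hz)

theorem limit_det {E : Type} [NormedAddCommGroup E] [NormedSpace ℂ E] [FiniteDimensional ℂ E]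
    {U : Set E} (hU : IsOpen U) (hUc : IsConnected U) {φ : ℕ → E → E} {ψ : E → E}
    (hφ : ∀ k, DifferentiableOn ℂ (φ k) U) (hi : ∀ k, InjOn (φ k) U)
    (hψ : DifferentiableOn ℂ ψ U) (hconv : TendstoLocallyUniformlyOn φ ψ atTop U) {x : E} (hx : x ∈ U)
    (hdet : LinearMap.det (fderiv ℂ ψ x : E →ₗ[ℂ] E) ≠ 0) :
    ∀ z ∈ U, LinearMap.det (fderiv ℂ ψ z : E →ₗ[ℂ] E) ≠ 0 := by
  set h : E → ℂ := fun z => LinearMap.det (fderiv ℂ ψ z : E →ₗ[ℂ] E) with hh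
  have hhd : DifferentiableOn ℂ h U := det_diff hU hψ
  let V : Set E := U ∩ h ⁻¹' {0}ᶜ
  have hV : IsOpen V := hhd.continuousOn.isOpen_inter_preimage hU isOpen_compl_singleton
  have hsub : U ⊆ V := by
    refine hUc.isPreconnected.subset_of_closure_inter_subset hV ⟨x, hx, hx, hdet⟩ ?_
    rintro z₀ ⟨hcl, hz⟩
    refine ⟨hz, fun h0 => ?_⟩
    have h0' : h z₀ = 0 := h0
    obtain ⟨ρ, hρ, hρU⟩ := Metric.isOpen_iff.1 hU z₀ hz
    obtain ⟨w, hwV, hw⟩ := Metric.mem_closure_iff.1 hcl ρ hρ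
    have hwb : w ∈ ball z₀ ρ := by rwa [mem_ball, dist_comm]
    have hnz := line_not_ev_zero hwb (hhd.mono hρU) hwV.2
    have hc : Continuous (fun ζ : ℂ => z₀ + ζ • (w - z₀)) := by fun_prop
    have hev : ∀ᶠ ζ in 𝓝 (0 : ℂ), z₀ + ζ • (w - z₀) ∈ U :=
      hc.continuousAt (hU.mem_nhds (by simpa using hz))
    obtain ⟨R, hR, hball⟩ := Metric.eventually_nhds_iff_ball.1 hev
    have hline : ∀ g : E → ℂ, DifferentiableOn ℂ g U →
        DifferentiableOn ℂ (fun ζ : ℂ => g (z₀ + ζ • (w - z₀))) (ball 0 R) := by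
      intro g hg ζ hζ
      have hm := hball ζ hζ
      exact (line_hasDerivAt ((hg _ hm).differentiableAt (hU.mem_nhds hm))).differentiableAt.differentiableWithinAt
    have hzz := hurwitz_zero (l := (atTop : Filter ℕ))
      (g := fun k ζ => LinearMap.det (fderiv ℂ (φ k) (z₀ + ζ • (w - z₀)) : E →ₗ[ℂ] E))
      (G := fun ζ => h (z₀ + ζ • (w - z₀))) hR
      (Eventually.of_forall fun k => hline _ (det_diff hU (hφ k))) (hline _ hhd)
      (by
        intro ζ hζ
        have h1 := det_conv hU hφ hψ hconv (hball ζ hζ)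
        exact h1.comp (tendsto_id.prodMap (hc.tendsto ζ)))
      (by simpa using h0') hnz
    obtain ⟨k, ζ, hζ, hk⟩ := hzz.exists
    exact osgood_det hU (hφ k) (hi k) (hball ζ hζ) hk
  exact fun z hz => (hsub hz).2

theorem hit_value {E : Type} [NormedAddCommGroup E] [NormedSpace ℂ E] [FiniteDimensional ℂ E]
    {U : Set E} (hU : IsOpen U) {φ : ℕ → E → E} {ψ : E → E}
    (hφ : ∀ k, DifferentiableOn ℂ (φ k) U)
    (hψ : DifferentiableOn ℂ ψ U) (hconv : TendstoLocallyUniformlyOn φ ψ atTop U) {a : E} (ha : a ∈ U)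
    (hdet : LinearMap.det (fderiv ℂ ψ a : E →ₗ[ℂ] E) ≠ 0) {δ : ℝ} (hδ : 0 < δ) :
    ∀ᶠ k in atTop, ∃ z ∈ U, dist z a ≤ δ ∧ φ k z = ψ a := by
  have : CompleteSpace E := FiniteDimensional.complete ℂ E
  let _ : NormedSpace ℝ E := NormedSpace.restrictScalars ℝ ℂ E
  rcases subsingleton_or_nontrivial E with hs | hnt
  · exact Eventually.of_forall fun k => ⟨a, ha, by simpa using hδ.le, Subsingleton.elim _ _⟩
  let B : E ≃L[ℂ] E := (LinearMap.equivOfDetNeZero (fderiv ℂ ψ a : E →ₗ[ℂ] E) hdet).toContinuousLinearEquiv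
  have hB : (B : E →L[ℂ] E) = fderiv ℂ ψ a := by ext z; rfl
  have hNpos : 0 < ‖(B.symm : E →L[ℂ] E)‖₊ := B.nnnorm_symm_pos
  set N := ‖(B.symm : E →L[ℂ] E)‖₊ with hN
  let c : NNReal := N⁻¹ / 2
  have hcN : (c : ℝ) = (N : ℝ)⁻¹ / 2 := by simp [c]
  have hcpos : 0 < (c : ℝ) := by rw [hcN]; positivity
  have h1 := Metric.tendsto_nhds.1 (fderiv_conv hU hφ hψ hconv ha) c hcpos
  obtain ⟨P1, hP1, P2, hP2, hP12⟩ := eventually_prod_iff.1 h1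
  obtain ⟨r, hr, hrP⟩ := Metric.eventually_nhds_iff_ball.1 (hP2.and (hU.mem_nhds ha))
  let ε : ℝ := min (r / 2) δ
  have hε : 0 < ε := by positivity
  have hεb : closedBall a ε ⊆ ball a r := closedBall_subset_ball ((min_le_left _ _).trans_lt (by linarith))
  have hpt := Metric.tendsto_nhds.1 (hconv.tendsto_at ha) ((c : ℝ) * ε) (by positivity)
  filter_upwards [hP1, hpt] with k hk hka
  have hA : ApproximatesLinearOn (φ k) (B : E →L[ℂ] E) (closedBall a ε) c := by
    intro z hz y hy
    rw [hB]
    refine (convex_closedBall a ε).norm_image_sub_le_of_norm_fderiv_le' (𝕜 := ℂ) ?_ ?_ hy hz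
    · intro w hw
      exact (hφ k w (hrP w (hεb hw)).2).differentiableAt (hU.mem_nhds (hrP w (hεb hw)).2)
    · intro w hw
      rw [← dist_eq_norm]
      exact (hP12 hk (hrP w (hεb hw)).1).le
  have hsurj := hA.surjOn_closedBall_of_nonlinearRightInverse B.toNonlinearRightInverse hε.le Subset.rfl
  have hmem : ψ a ∈ closedBall (φ k a) (((B.toNonlinearRightInverse.nnnorm : ℝ)⁻¹ - c) * ε) := by
    have : (B.toNonlinearRightInverse.nnnorm : ℝ) = N := rfl
    rw [this, mem_closedBall, dist_comm]
    have : (N : ℝ)⁻¹ - c = c := by rw [hcN]; ring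
    rw [this]
    exact hka.le
  obtain ⟨z, hz, hzz⟩ := hsurj hmem
  exact ⟨z, (hrP z (hεb hz)).2, (mem_closedBall.1 hz).trans (min_le_right _ _), hzz⟩

theorem limit_inj {E : Type} [NormedAddCommGroup E] [NormedSpace ℂ E] [FiniteDimensional ℂ E]
    {U : Set E} (hU : IsOpen U) {φ : ℕ → E → E} {ψ : E → E}
    (hφ : ∀ k, DifferentiableOn ℂ (φ k) U) (hi : ∀ k, InjOn (φ k) U)
    (hψ : DifferentiableOn ℂ ψ U) (hconv : TendstoLocallyUniformlyOn φ ψ atTop U)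
    (hdet : ∀ z ∈ U, LinearMap.det (fderiv ℂ ψ z : E →ₗ[ℂ] E) ≠ 0) : InjOn ψ U := by
  intro a ha b hb hab
  by_contra hne
  have hd : 0 < dist a b := dist_pos.2 hne
  have h1 := hit_value hU hφ hψ hconv ha (hdet a ha) (δ := dist a b / 3) (by positivity)
  have h2 := hit_value hU hφ hψ hconv hb (hdet b hb) (δ := dist a b / 3) (by positivity)
  obtain ⟨k, ⟨z, hz, hza, hzv⟩, ⟨y, hy, hyb, hyv⟩⟩ := (h1.and h2).exists
  have : z = y := hi k hz hy (by rw [hzv, hyv, hab])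
  subst this
  have := dist_triangle_left a b z
  linarith

end SCV

/-- Hurwitz-type theorem in several variables: a locally uniform
limit of injective holomorphic maps with nondegenerate differential at one
point has everywhere nonvanishing Jacobian and is injective. -/
theorem stmt_3 {m : ℕ} (U : Set (Fin m → ℂ)) (hU : IsOpen U) (hUc : IsConnected U)
    (φ : ℕ → (Fin m → ℂ) → (Fin m → ℂ)) (ψ : (Fin m → ℂ) → (Fin m → ℂ))
    (hφhol : ∀ k, DifferentiableOn ℂ (φ k) U)
    (hφinj : ∀ k, InjOn (φ k) U)
    (hψhol : DifferentiableOn ℂ ψ U)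
    (hconv : TendstoLocallyUniformlyOn φ ψ Filter.atTop U)
    (x : Fin m → ℂ) (hx : x ∈ U)
    (hdet : LinearMap.det (fderiv ℂ ψ x : (Fin m → ℂ) →ₗ[ℂ] (Fin m → ℂ)) ≠ 0) :
    (∀ z ∈ U, LinearMap.det
        (fderiv ℂ ψ z : (Fin m → ℂ) →ₗ[ℂ] (Fin m → ℂ)) ≠ 0) ∧ InjOn ψ U := by
  have h := limit_det hU hUc hφhol hφinj hψhol hconv hx hdet
  exact ⟨h, limit_inj hU hφhol hφinj hψhol hconv h⟩
end
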